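/- Let G : 𝔻 → ℂ be holomorphic generating a semiflow (φ_t)_{t≥0} on 𝔻, and suppose there exist δ > 0 and ε > 0 such that Re(z̄ G(z)) ≤ −δ for all z with 1 − ε < |z| < 1. Then the operator A : f ↦ G·f′ generates an immediately compact semigroup of composition operators on H²(𝔻) and on the Dirichlet space 𝒟; indeed the semigroup is immediately trace-class. Moreover, there exists t₀ > 0 such that ‖φ_t‖_∞ ≤ max{√(1 − 2δt), √((1−ε)² + t₀M)} < 1 for all 0 < t ≤ t₀. -/

import Mathlib

open Complex MeasureTheory Filter Set Metric
open scoped Real Topology ENNReal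

noncomputable section

/-- The weighted Hardy space `H²(β)`, modeled as the `ℓ²` space of weighted
Taylor coefficient sequences: the function `f(z) = Σ cₙ zⁿ` corresponds to the
square-summable sequence `(cₙ βₙ)ₙ`. -/
abbrev WH2 : Type := lp (fun _ : ℕ => ℂ) 2

/-- The analytic function on the unit disc associated to an element of `H²(β)`. -/
def wToFun (β : ℕ → ℝ) (f : WH2) (z : ℂ) : ℂ := ∑' n : ℕ, (f n / (β n : ℂ)) * z ^ n

/-- The open unit disc. -/
def uDisc : Set ℂ := Metric.ball 0 1

/-- Weights of the classical Hardy space `H²(𝔻)` (`βₙ = 1`). -/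
def hardyW : ℕ → ℝ := fun _ => 1

/-- Weights of the Dirichlet space `𝒟` (`β₀ = 1`, `βₙ = √n`). -/
def dirichletW : ℕ → ℝ := fun n => if n = 0 then 1 else Real.sqrt n

/-- The monomial `eₙ(z) = zⁿ` as an element of `H²(β)`. -/
def eW (β : ℕ → ℝ) (n : ℕ) : WH2 := lp.single 2 n ((β n : ℝ) : ℂ)

/-- `T` acts as the composition operator with analytic self-map symbol `φ` on `H²(β)`. -/
def RepresentsComp (β : ℕ → ℝ) (T : WH2 →L[ℂ] WH2) (φ : ℂ → ℂ) : Prop :=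
  DifferentiableOn ℂ φ uDisc ∧ MapsTo φ uDisc uDisc ∧
  ∀ f : WH2, ∀ z ∈ uDisc, wToFun β (T f) z = wToFun β f (φ z)

/-- `T` is a composition operator on `H²(β)`. -/
def IsCompositionOperator (β : ℕ → ℝ) (T : WH2 →L[ℂ] WH2) : Prop :=
  ∃ φ : ℂ → ℂ, RepresentsComp β T φ

/-- `T` is a weighted composition operator `f ↦ w · (f ∘ φ)` on `H²(𝔻)`. -/
def IsWeightedCompOp (T : WH2 →L[ℂ] WH2) : Prop :=
  ∃ w φ : ℂ → ℂ, DifferentiableOn ℂ w uDisc ∧ DifferentiableOn ℂ φ uDisc ∧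
    MapsTo φ uDisc uDisc ∧
    ∀ f : WH2, ∀ z ∈ uDisc, wToFun hardyW (T f) z = w z * wToFun hardyW f (φ z)

section Semigroup

variable {X : Type*} [NormedAddCommGroup X] [NormedSpace ℂ X]

/-- `T` is a `C₀`-semigroup (indexed by `t ≥ 0`). -/
def IsC0Semigroup (T : ℝ → X →L[ℂ] X) : Prop :=
  T 0 = 1 ∧ (∀ s t : ℝ, 0 ≤ s → 0 ≤ t → T (s + t) = (T s).comp (T t)) ∧
  ∀ x : X, Tendsto (fun t : ℝ => T t x) (𝓝[≥] 0) (𝓝 x)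

/-- `T` is a `C₀`-group (indexed by `t ∈ ℝ`). -/
def IsC0Group (T : ℝ → X →L[ℂ] X) : Prop :=
  T 0 = 1 ∧ (∀ s t : ℝ, T (s + t) = (T s).comp (T t)) ∧
  ∀ x : X, Tendsto (fun t : ℝ => T t x) (𝓝 0) (𝓝 x)

/-- Quasicontractive: `‖T(t)‖ ≤ e^{wt}` for some `w ≥ 0` and all `t ≥ 0`. -/
def Quasicontractive (T : ℝ → X →L[ℂ] X) : Prop :=
  ∃ w : ℝ, 0 ≤ w ∧ ∀ t : ℝ, 0 ≤ t → ‖T t‖ ≤ Real.exp (w * t)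

/-- The sector `Σ_θ = {re^{iα} : r ≥ 0, |α| < θ}` (note `arg 0 = 0`). -/
def Sector (θ : ℝ) : Set ℂ := {z : ℂ | |Complex.arg z| < θ}

/-- `Te` is an analytic extension of the semigroup `T` to the sector `Σ_θ`,
bounded on `Σ_θ ∩ 𝔻`. -/
def IsAnalyticExtension (T : ℝ → X →L[ℂ] X) (θ : ℝ) (Te : ℂ → X →L[ℂ] X) : Prop :=
  (∀ t : ℝ, 0 ≤ t → Te t = T t) ∧
  DifferentiableOn ℂ Te (Sector θ \ {0}) ∧
  ∃ M : ℝ, ∀ ξ ∈ Sector θ, ‖ξ‖ < 1 → ‖Te ξ‖ ≤ M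

/-- The semigroup `T` extends analytically and boundedly to the sector `Σ_θ`. -/
def HasAnalyticExtension (T : ℝ → X →L[ℂ] X) (θ : ℝ) : Prop :=
  ∃ Te : ℂ → X →L[ℂ] X, IsAnalyticExtension T θ Te

/-- The semigroup `T` is analytic (on some sector `Σ_θ`, `θ ∈ (0, π/2]`). -/
def IsAnalyticSemigroup (T : ℝ → X →L[ℂ] X) : Prop :=
  ∃ θ ∈ Set.Ioc 0 (π / 2), HasAnalyticExtension T θ

/-- `y` is the limit of `(T(t)x - x)/t` as `t → 0⁺`. -/
def GenLimit (T : ℝ → X →L[ℂ] X) (x y : X) : Prop :=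
  Tendsto (fun t : ℝ => (t : ℂ)⁻¹ • (T t x - x)) (𝓝[>] 0) (𝓝 y)

/-- `A`, with domain `D`, is the infinitesimal generator of the semigroup `T`. -/
def IsGenerator (T : ℝ → X →L[ℂ] X) (D : Set X) (A : X → X) : Prop :=
  (∀ x ∈ D, GenLimit T x (A x)) ∧ ∀ x : X, (∃ y, GenLimit T x y) → x ∈ D

/-- `y` is the two-sided limit of `(T(t)x - x)/t` as `t → 0` (for groups). -/
def GenLimitGrp (T : ℝ → X →L[ℂ] X) (x y : X) : Prop :=
  Tendsto (fun t : ℝ => (t : ℂ)⁻¹ • (T t x - x)) (𝓝[≠] 0) (𝓝 y)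

/-- `A`, with domain `D`, is the infinitesimal generator of the group `T`. -/
def IsGeneratorGrp (T : ℝ → X →L[ℂ] X) (D : Set X) (A : X → X) : Prop :=
  (∀ x ∈ D, GenLimitGrp T x (A x)) ∧ ∀ x : X, (∃ y, GenLimitGrp T x y) → x ∈ D

/-- Immediately compact semigroup: `T(t)` is compact for all `t > 0`. -/
def ImmediatelyCompact (T : ℝ → X →L[ℂ] X) : Prop :=
  ∀ t : ℝ, 0 < t → IsCompactOperator (T t)

/-- Eventually compact semigroup: `T(t)` is compact for all `t ≥ t₀`, some `t₀ > 0`. -/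
def EventuallyCompact (T : ℝ → X →L[ℂ] X) : Prop :=
  ∃ t₀ : ℝ, 0 < t₀ ∧ ∀ t : ℝ, t₀ ≤ t → IsCompactOperator (T t)

end Semigroup

/-- The natural domain of the operator `A f = G f'` in `H²(β)`: those `f` for which
`G · (wToFun β f)'` is realized by some element of `H²(β)`. -/
def domA (β : ℕ → ℝ) (G : ℂ → ℂ) : Set WH2 :=
  {f : WH2 | ∃ g : WH2, ∀ z ∈ uDisc, wToFun β g z = G z * deriv (wToFun β f) z}

open Classical in
/-- The operator `A f = G f'` on `H²(β)` (defined via choice on its natural domain). -/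
def opA (β : ℕ → ℝ) (G : ℂ → ℂ) (f : WH2) : WH2 :=
  if h : f ∈ domA β G then h.choose else 0

/-- `(φ_t)_{t ≥ 0}` is a (jointly continuous) semiflow of analytic self-maps of `𝔻`. -/
def IsSemiflow (φ : ℝ → ℂ → ℂ) : Prop :=
  (∀ z ∈ uDisc, φ 0 z = z) ∧
  (∀ t : ℝ, 0 ≤ t → DifferentiableOn ℂ (φ t) uDisc ∧ MapsTo (φ t) uDisc uDisc) ∧
  (∀ s t : ℝ, 0 ≤ s → 0 ≤ t → ∀ z ∈ uDisc, φ (s + t) z = φ s (φ t z)) ∧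
  ContinuousOn (fun p : ℝ × ℂ => φ p.1 p.2) (Set.Ici 0 ×ˢ uDisc)

/-- `G` is the infinitesimal generator of the semiflow `φ`: `∂φ_t/∂t = G ∘ φ_t`. -/
def SemiflowGenerator (φ : ℝ → ℂ → ℂ) (G : ℂ → ℂ) : Prop :=
  ∀ z ∈ uDisc, ∀ t : ℝ, 0 ≤ t → HasDerivAt (fun s : ℝ => φ s z) (G (φ t z)) t

/-- Hilbert–Schmidt operator on `WH2` (w.r.t. the standard orthonormal basis). -/
def IsHilbertSchmidt (T : WH2 →L[ℂ] WH2) : Prop :=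
  Summable (fun n : ℕ => ‖T (lp.single 2 n (1 : ℂ))‖ ^ 2)

/-- Trace-class operator on `WH2`: a product of two Hilbert–Schmidt operators. -/
def IsTraceClass (T : WH2 →L[ℂ] WH2) : Prop :=
  ∃ A B : WH2 →L[ℂ] WH2, IsHilbertSchmidt A ∧ IsHilbertSchmidt B ∧ T = A.comp B

/-- `‖φ‖_∞ < 1` for a function on the unit disc. -/
def SupNormLtOne (φ : ℂ → ℂ) : Prop :=
  ∃ r : ℝ, r < 1 ∧ ∀ z ∈ uDisc, ‖φ z‖ ≤ r

/-- Essential boundary condition via radial limits: for almost every boundary point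
`ξ = e^{it}`, whenever the radial limit `L` of `G` at `ξ` exists,
`Re (e^{iα} ξ̄ L) ≤ c`.  (This encodes `ess sup_(z ∈ 𝕋) Re (e^{iα} z̄ G(z)) ≤ c`.) -/
def BoundaryReLe (G : ℂ → ℂ) (α : ℝ) (c : ℝ) : Prop :=
  ∀ᵐ t : ℝ, ∀ L : ℂ,
    Tendsto (fun r : ℝ => G ((r : ℂ) * Complex.exp ((t : ℂ) * Complex.I)))
      (𝓝[<] 1) (𝓝 L) →
    (Complex.exp ((α : ℂ) * Complex.I) *
      (starRingEnd ℂ) (Complex.exp ((t : ℂ) * Complex.I)) * L).re ≤ c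

/-- `Re (z̄ G(z)) = 0` almost everywhere on the unit circle, via radial limits. -/
def BoundaryReEqZero (G : ℂ → ℂ) : Prop :=
  ∀ᵐ t : ℝ, ∀ L : ℂ,
    Tendsto (fun r : ℝ => G ((r : ℂ) * Complex.exp ((t : ℂ) * Complex.I)))
      (𝓝[<] 1) (𝓝 L) →
    ((starRingEnd ℂ) (Complex.exp ((t : ℂ) * Complex.I)) * L).re = 0

end

/-- Integrals of a trigonometric series against a function, computed termwise. -/
theorem hasSum_integral_mul_expSeries {b : ℕ → ℂ} (hb : Summable fun n => ‖b n‖)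
    {e : ℕ → ℝ → ℂ} (he : ∀ n, Continuous (e n)) (he1 : ∀ n θ, ‖e n θ‖ = 1)
    {g : ℝ → ℂ} (hg : Continuous g) :
    HasSum (fun n => b n * ∫ θ in (-π)..π, e n θ * g θ)
      (∫ θ in (-π)..π, (∑' n, b n * e n θ) * g θ) := by
  have h := intervalIntegral.hasSum_integral_of_dominated_convergence (μ := volume)
    (a := -π) (b := π) (F := fun n θ => b n * (e n θ * g θ))
    (f := fun θ => (∑' n, b n * e n θ) * g θ) (fun n θ => ‖b n‖ * ‖g θ‖)
    (fun n => by
      have := he n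
      exact (by fun_prop : Continuous fun θ => b n * (e n θ * g θ)).aestronglyMeasurable)
    (fun n => by simp [he1])
    (by
      refine Eventually.of_forall fun θ _ => ?_
      exact hb.mul_right _)
    (by
      simp_rw [tsum_mul_right]
      exact (by fun_prop : Continuous fun θ => (∑' n, ‖b n‖) * ‖g θ‖).intervalIntegrable _ _)
    (by
      refine Eventually.of_forall fun θ _ => ?_
      simp_rw [← mul_assoc]
      refine HasSum.mul_right _ (Summable.hasSum ?_)
      refine Summable.of_norm ?_
      simpa [he1] using hb)
  simpa [intervalIntegral.integral_const_mul] using h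

theorem integral_exp_int_mul_I {k : ℤ} (hk : k ≠ 0) :
    ∫ θ in (-π)..π, cexp (k * θ * I) = 0 := by
  have hk' : (k : ℂ) * I ≠ 0 := by simp [hk]
  have h := integral_exp_mul_complex (a := -π) (b := π) hk'
  have h2 : cexp (k * I * ((π : ℝ) : ℂ)) = cexp (k * I * ((-π : ℝ) : ℂ)) := by
    rw [Complex.exp_eq_exp_iff_exists_int]
    exact ⟨k, by push_cast; ring⟩
  rw [h2, sub_self, zero_div] at h
  rw [← h]
  congr 1 with θ
  ring_nf

theorem norm_exp_nat_mul_I (n : ℕ) (θ : ℝ) : ‖cexp (n * θ * I)‖ = 1 := by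
  exact_mod_cast Complex.norm_exp_ofReal_mul_I (n * θ)

theorem norm_exp_neg_nat_mul_I (n : ℕ) (θ : ℝ) : ‖cexp (-(n * θ) * I)‖ = 1 := by
  exact_mod_cast Complex.norm_exp_ofReal_mul_I (-(n * θ))

theorem continuous_expSeries {b : ℕ → ℂ} (hb : Summable fun n => ‖b n‖) :
    Continuous fun θ : ℝ => ∑' n, b n * cexp (n * θ * I) := by
  refine continuous_tsum (fun n => by fun_prop) hb fun n θ => ?_
  simp [norm_exp_nat_mul_I]

/-- Parseval's identity for an absolutely convergent one-sided trigonometric series. -/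
theorem lintegral_expSeries_sq {b : ℕ → ℂ} (hb : Summable fun n => ‖b n‖) :
    ∫⁻ θ in Ioo (-π) π, ‖∑' n, b n * cexp (n * (θ : ℝ) * I)‖ₑ ^ 2 =
      ENNReal.ofReal (2 * π) * ∑' n, ‖b n‖ₑ ^ 2 := by
  set g : ℝ → ℂ := fun θ => ∑' n, b n * cexp (n * θ * I) with hgdef
  have hg : Continuous g := continuous_expSeries hb
  have hJ (n : ℕ) : ∫ θ in (-π)..π, cexp (-(n * θ) * I) * g θ = 2 * π * b n := by
    have h := hasSum_integral_mul_expSeries hb (e := fun m θ => cexp (m * θ * I))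
      (fun m => by fun_prop) norm_exp_nat_mul_I
      (g := fun θ => cexp (-(n * θ) * I)) (by fun_prop)
    have h2 := h.unique (hasSum_single n fun m hm => ?_)
    · have : (fun θ : ℝ => cexp (-(n * θ) * I) * g θ) =
          fun θ : ℝ => (∑' n, b n * cexp (n * θ * I)) * cexp (-(n * θ) * I) := by
        ext θ; rw [mul_comm]
      rw [this, h2]
      have h1 : ∀ θ : ℝ, cexp (n * θ * I) * cexp (-(n * θ) * I) = 1 := fun θ => by
        rw [← Complex.exp_add]; simp
      simp_rw [h1]
      simp
      ring
    · have h3 := integral_exp_int_mul_I (k := (m : ℤ) - n) (by omega)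
      have h4 : ∀ θ : ℝ, cexp (m * θ * I) * cexp (-(n * θ) * I) =
          cexp (((m : ℤ) - n : ℤ) * θ * I) := fun θ => by
        rw [← Complex.exp_add]; push_cast; ring_nf
      simp_rw [h4, h3, mul_zero]
  have hconj (θ : ℝ) : (starRingEnd ℂ) (g θ) =
      ∑' n, (starRingEnd ℂ) (b n) * cexp (-(n * θ) * I) := by
    rw [hgdef, Complex.conj_tsum]
    congr 1 with n
    rw [map_mul, ← Complex.exp_conj]
    simp
  have hmain := hasSum_integral_mul_expSeries (b := fun n => (starRingEnd ℂ) (b n))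
    (by simpa using hb) (e := fun n θ => cexp (-(n * θ) * I)) (fun m => by fun_prop)
    norm_exp_neg_nat_mul_I hg
  simp_rw [hJ, ← hconj] at hmain
  have hsq : Summable fun n => ‖b n‖ ^ 2 := by
    refine Summable.of_norm_bounded_eventually_nat hb ?_
    filter_upwards [hb.tendsto_atTop_zero.eventually (gt_mem_nhds one_pos)] with n hn
    rw [norm_pow, norm_norm, sq]
    exact mul_le_of_le_one_left (norm_nonneg _) hn.le
  have hreal : ∫ θ in (-π)..π, ‖g θ‖ ^ 2 = 2 * π * ∑' n, ‖b n‖ ^ 2 := by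
    have h5 : ∀ θ, (starRingEnd ℂ) (g θ) * g θ = ((‖g θ‖ ^ 2 : ℝ) : ℂ) := fun θ => by
      rw [Complex.conj_mul']; push_cast; ring
    have h6 : ∀ n, (starRingEnd ℂ) (b n) * (2 * π * b n) = ((2 * π * ‖b n‖ ^ 2 : ℝ) : ℂ) :=
      fun n => by
        have := Complex.conj_mul' (b n)
        push_cast
        linear_combination 2 * (π : ℂ) * this
    simp_rw [h5, h6] at hmain
    rw [intervalIntegral.integral_ofReal] at hmain
    have := (Complex.hasSum_ofReal.1 hmain).tsum_eq
    rw [← this, tsum_mul_left]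
  have hle : -π ≤ π := by linarith [Real.pi_pos]
  have h7 (x : ℂ) : ‖x‖ₑ ^ 2 = ENNReal.ofReal (‖x‖ ^ 2) := by
    rw [← ofReal_norm, ENNReal.ofReal_pow (norm_nonneg _)]
  simp_rw [h7]
  rw [← ENNReal.ofReal_tsum_of_nonneg (fun n => by positivity) hsq,
    ← ENNReal.ofReal_mul (by positivity), ← hreal,
    intervalIntegral.integral_of_le hle, integral_Ioc_eq_integral_Ioo,
    ofReal_integral_eq_lintegral_ofReal]
  · have : Continuous fun θ => ‖g θ‖ ^ 2 := by fun_prop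
    exact (this.integrableOn_Icc (a := -π) (b := π)).mono_set Ioo_subset_Icc_self
  · exact Eventually.of_forall fun θ => by positivity

noncomputable section

/-- The `n`-th Taylor coefficient of `F` at the origin. -/
def taylorCoeff (F : ℂ → ℂ) (n : ℕ) : ℂ := (n.factorial : ℂ)⁻¹ * iteratedDeriv n F 0

/-- The weighted area integral `∫_𝔻 |F'(z)|² (1 - p|z|²) dA(z)`. -/
def areaEnergy (p : ℝ) (F : ℂ → ℂ) : ℝ≥0∞ :=
  ∫⁻ z in ball (0 : ℂ) 1, ‖deriv F z‖ₑ ^ 2 * ENNReal.ofReal (1 - p * ‖z‖ ^ 2)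

/-- The weight with which the `n`-th Taylor coefficient enters the weighted area integral. -/
def areaWeight (p : ℝ) (n : ℕ) : ℝ := (n : ℝ) ^ 2 * ((n : ℝ)⁻¹ - p * ((n : ℝ) + 1)⁻¹)

end

theorem hasSum_taylorCoeff {F : ℂ → ℂ} (hF : DifferentiableOn ℂ F (ball 0 1)) {z : ℂ}
    (hz : z ∈ ball (0 : ℂ) 1) : HasSum (fun n => taylorCoeff F n * z ^ n) (F z) := by
  have h := hasSum_taylorSeries_on_ball hF hz
  have h2 : (fun n => taylorCoeff F n * z ^ n) =
      fun n => ((n.factorial : ℂ)⁻¹ • (z - 0) ^ n • iteratedDeriv n F 0) := by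
    funext n
    simp only [taylorCoeff, sub_zero, smul_eq_mul]
    ring
  rwa [h2]

theorem taylorCoeff_deriv (F : ℂ → ℂ) (n : ℕ) :
    taylorCoeff (deriv F) n = (n + 1) * taylorCoeff F (n + 1) := by
  rw [taylorCoeff, taylorCoeff, iteratedDeriv_succ', Nat.factorial_succ]
  have : (n.factorial : ℂ) ≠ 0 := by exact_mod_cast n.factorial_ne_zero
  have : (n + 1 : ℂ) ≠ 0 := by exact_mod_cast n.succ_ne_zero
  push_cast
  field_simp

theorem ofReal_mul_exp_mem_ball {r : ℝ} (hr : r ∈ Ioo (0 : ℝ) 1) (θ : ℝ) :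
    (r : ℂ) * cexp (θ * I) ∈ ball (0 : ℂ) 1 := by
  simp [norm_exp_ofReal_mul_I, abs_of_pos hr.1, hr.2]

theorem lintegral_circle_sq {a : ℕ → ℂ} {F : ℂ → ℂ}
    (hF : ∀ z ∈ ball (0 : ℂ) 1, HasSum (fun n => a n * z ^ n) (F z)) {r : ℝ}
    (hr : r ∈ Ioo (0 : ℝ) 1) :
    ∫⁻ θ in Ioo (-π) π, ‖F (r * cexp ((θ : ℝ) * I))‖ₑ ^ 2 =
      ENNReal.ofReal (2 * π) * ∑' n, ‖a n‖ₑ ^ 2 * ENNReal.ofReal (r ^ (2 * n)) := by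
  have hs : Summable fun n => ‖a n * (r : ℂ) ^ n‖ :=
    (hF r (by simp [abs_of_pos hr.1, hr.2])).summable.norm
  have h1 (θ : ℝ) : F (r * cexp (θ * I)) = ∑' n, a n * (r : ℂ) ^ n * cexp (n * θ * I) := by
    rw [← (hF _ (ofReal_mul_exp_mem_ball hr θ)).tsum_eq]
    congr 1 with n
    rw [mul_pow, ← Complex.exp_nat_mul]
    ring_nf
  simp_rw [h1]
  rw [lintegral_expSeries_sq hs]
  congr 2 with n
  rw [enorm_mul, mul_pow, enorm_pow, ← ofReal_norm (r : ℂ), ← ENNReal.ofReal_pow (by positivity),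
    ← ENNReal.ofReal_pow (by positivity), ← pow_mul, Complex.norm_real, Real.norm_of_nonneg hr.1.le,
    mul_comm n]

theorem lintegral_ball_polar (f : ℂ → ℝ≥0∞) :
    ∫⁻ z in ball (0 : ℂ) 1, f z =
      ∫⁻ q in Ioo (0 : ℝ) 1 ×ˢ Ioo (-π) π,
        ENNReal.ofReal q.1 * f ((q.1 : ℂ) * cexp ((q.2 : ℝ) * I)) := by
  have hms : MeasurableSet (Ioo (0 : ℝ) 1 ×ˢ Ioo (-π) π) := measurableSet_Ioo.prod measurableSet_Ioo
  have hmt : MeasurableSet (polarCoord.target) := polarCoord.open_target.measurableSet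
  rw [← lintegral_indicator measurableSet_ball, ← Complex.lintegral_comp_polarCoord_symm,
    ← lintegral_indicator hmt, ← lintegral_indicator hms]
  congr 1 with q
  have h1 : (Complex.polarCoord.symm q : ℂ) = (q.1 : ℂ) * cexp ((q.2 : ℝ) * I) := by
    rw [Complex.polarCoord_symm_apply, Complex.exp_mul_I]
    push_cast
    rfl
  by_cases hq : q ∈ polarCoord.target
  · have hq' := hq
    simp only [polarCoord_target, mem_prod, mem_Ioi] at hq'
    rw [indicator_of_mem hq, smul_eq_mul, h1]
    by_cases h2 : q.1 < 1
    · rw [indicator_of_mem, indicator_of_mem]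
      · exact ⟨⟨hq'.1, h2⟩, hq'.2⟩
      · exact ofReal_mul_exp_mem_ball ⟨hq'.1, h2⟩ _
    · rw [indicator_of_notMem, indicator_of_notMem, mul_zero]
      · exact fun h => h2 h.1.2
      · simpa [norm_exp_ofReal_mul_I, abs_of_pos hq'.1] using h2
  · rw [indicator_of_notMem hq, indicator_of_notMem]
    exact fun h => hq ⟨h.1.1, h.2⟩

theorem lintegral_radial (p : ℝ) (hp : p ≤ 1) (n : ℕ) :
    ∫⁻ r in Ioo (0 : ℝ) 1, ENNReal.ofReal (r * (1 - p * r ^ 2) * r ^ (2 * n)) =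
      ENNReal.ofReal ((2 * (n + 1) : ℝ)⁻¹ - p * (2 * (n + 2) : ℝ)⁻¹) := by
  rw [← ofReal_integral_eq_lintegral_ofReal]
  · rw [← integral_Ioc_eq_integral_Ioo, ← intervalIntegral.integral_of_le zero_le_one]
    congr 1
    have : ∀ r : ℝ, r * (1 - p * r ^ 2) * r ^ (2 * n) = r ^ (2 * n + 1) - p * r ^ (2 * n + 3) := by
      intro r; ring
    simp_rw [this]
    rw [intervalIntegral.integral_sub (Continuous.intervalIntegrable (by fun_prop) _ _)
        (Continuous.intervalIntegrable (by fun_prop) _ _),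
      intervalIntegral.integral_const_mul, integral_pow, integral_pow]
    push_cast
    simp only [one_pow, ne_eq, Nat.add_eq_zero_iff, one_ne_zero, and_false, not_false_eq_true,
      zero_pow, sub_zero, OfNat.ofNat_ne_zero]
    field_simp
    ring
  · have : Continuous fun r : ℝ => r * (1 - p * r ^ 2) * r ^ (2 * n) := by fun_prop
    exact (this.integrableOn_Icc (a := 0) (b := 1)).mono_set Ioo_subset_Icc_self
  · refine (ae_restrict_iff' measurableSet_Ioo).2 (Eventually.of_forall fun r hr => ?_)
    have h1 : p * r ^ 2 ≤ 1 := by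
      have := hr.1; have := hr.2
      nlinarith [sq_nonneg r]
    have := hr.1
    have : 0 ≤ 1 - p * r ^ 2 := by linarith
    simp only [Pi.zero_apply]
    positivity

theorem areaEnergy_eq {p : ℝ} (hp : p ≤ 1) {F : ℂ → ℂ} (hF : DifferentiableOn ℂ F (ball 0 1)) :
    areaEnergy p F =
      ENNReal.ofReal π * ∑' n, ENNReal.ofReal (areaWeight p n) * ‖taylorCoeff F n‖ₑ ^ 2 := by
  have hF' : DifferentiableOn ℂ (deriv F) (ball 0 1) := hF.deriv isOpen_ball
  have hcont : ContinuousOn (fun q : ℝ × ℝ => deriv F ((q.1 : ℂ) * cexp ((q.2 : ℝ) * I)))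
      (Ioo (0 : ℝ) 1 ×ˢ Ioo (-π) π) := by
    refine hF'.continuousOn.comp (by fun_prop) fun q hq => ofReal_mul_exp_mem_ball hq.1 _
  have hms : MeasurableSet (Ioo (0 : ℝ) 1 ×ˢ Ioo (-π) π) := measurableSet_Ioo.prod measurableSet_Ioo
  have hnorm : ∀ q : ℝ × ℝ, ‖(q.1 : ℂ) * cexp ((q.2 : ℝ) * I)‖ ^ 2 = q.1 ^ 2 := fun q => by
    simp [norm_exp_ofReal_mul_I]
  rw [areaEnergy, lintegral_ball_polar]
  simp_rw [hnorm]
  rw [Measure.volume_eq_prod, setLIntegral_prod]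
  swap
  · have h1 := hcont.aemeasurable hms (μ := volume)
    have h2 : Measurable fun q : ℝ × ℝ => ENNReal.ofReal q.1 := by fun_prop
    have h3 : Measurable fun q : ℝ × ℝ => ENNReal.ofReal (1 - p * q.1 ^ 2) := by fun_prop
    exact h2.aemeasurable.mul ((h1.enorm.pow_const 2).mul h3.aemeasurable)
  have hin : ∀ r ∈ Ioo (0 : ℝ) 1,
      ∫⁻ θ in Ioo (-π) π, ENNReal.ofReal r * (‖deriv F (r * cexp ((θ : ℝ) * I))‖ₑ ^ 2 *
        ENNReal.ofReal (1 - p * r ^ 2)) =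
      ∑' n, ENNReal.ofReal (2 * π) * ‖taylorCoeff (deriv F) n‖ₑ ^ 2 *
        ENNReal.ofReal (r * (1 - p * r ^ 2) * r ^ (2 * n)) := by
    intro r hr
    rw [lintegral_const_mul' _ _ ENNReal.ofReal_ne_top,
      lintegral_mul_const' _ _ ENNReal.ofReal_ne_top,
      lintegral_circle_sq (fun z hz => hasSum_taylorCoeff hF' hz) hr]
    rw [← ENNReal.tsum_mul_left, ← ENNReal.tsum_mul_right, ← ENNReal.tsum_mul_left]
    congr 1 with n
    have h1 : p * r ^ 2 ≤ 1 := by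
      have := hr.1; have := hr.2
      nlinarith [sq_nonneg r]
    rw [ENNReal.ofReal_mul (mul_nonneg hr.1.le (by linarith)), ENNReal.ofReal_mul hr.1.le]
    ring
  rw [setLIntegral_congr_fun measurableSet_Ioo hin, lintegral_tsum (fun n => by fun_prop),
    ← ENNReal.tsum_mul_left]
  rw [tsum_eq_zero_add' (f := fun n => ENNReal.ofReal π *
    (ENNReal.ofReal (areaWeight p n) * ‖taylorCoeff F n‖ₑ ^ 2)) ENNReal.summable]
  simp only [areaWeight, Nat.cast_zero, ne_eq, OfNat.ofNat_ne_zero, not_false_eq_true, zero_pow,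
    zero_mul, ENNReal.ofReal_zero, mul_zero, zero_add]
  congr 1 with n
  rw [lintegral_const_mul _ (by fun_prop), lintegral_radial p hp, taylorCoeff_deriv, enorm_mul,
    mul_pow]
  have h1 : ‖(n + 1 : ℂ)‖ₑ ^ 2 = ENNReal.ofReal ((n + 1 : ℝ) ^ 2) := by
    rw [← ofReal_norm, ← ENNReal.ofReal_pow (norm_nonneg _)]
    congr 2
    exact_mod_cast Complex.norm_natCast (n + 1)
  rw [h1]
  have h2 : ENNReal.ofReal (2 * π) * ENNReal.ofReal ((n + 1 : ℝ) ^ 2) *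
      ENNReal.ofReal ((2 * (n + 1) : ℝ)⁻¹ - p * (2 * (n + 2) : ℝ)⁻¹) =
      ENNReal.ofReal π * ENNReal.ofReal (((n + 1 : ℕ) : ℝ) ^ 2 *
        (((n + 1 : ℕ) : ℝ)⁻¹ - p * (((n + 1 : ℕ) : ℝ) + 1)⁻¹)) := by
    rw [← ENNReal.ofReal_mul (by positivity), ← ENNReal.ofReal_mul (by positivity),
      ← ENNReal.ofReal_mul (by positivity)]
    congr 1
    push_cast
    field_simp
    ring
  rw [← mul_assoc (ENNReal.ofReal π), ← h2]
  ring

/-- The weight `β` defines a space whose norm is comparable, away from constants, to the area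
integral of `|F'(z)|² (1 - p|z|²)`. -/
structure IsAreaSpace (β : ℕ → ℝ) (p : ℝ) : Prop where
  p_nonneg : 0 ≤ p
  p_le_one : p ≤ 1
  beta_zero : β 0 = 1
  one_le : ∀ n, 1 ≤ β n
  areaWeight_le : ∀ n, areaWeight p n ≤ β n ^ 2
  le_areaWeight : ∀ n, n ≠ 0 → β n ^ 2 ≤ 2 * areaWeight p n

theorem isAreaSpace_hardyW : IsAreaSpace hardyW 1 where
  p_nonneg := zero_le_one
  p_le_one := le_rfl
  beta_zero := rfl
  one_le _ := le_rfl
  areaWeight_le n := by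
    rcases Nat.eq_zero_or_pos n with rfl | hn
    · simp [areaWeight, hardyW]
    · have : (0 : ℝ) < n := by exact_mod_cast hn
      simp only [areaWeight, hardyW]
      field_simp
      linarith
  le_areaWeight n hn := by
    have : (1 : ℝ) ≤ n := by exact_mod_cast Nat.one_le_iff_ne_zero.2 hn
    simp only [areaWeight, hardyW]
    field_simp
    linarith

theorem isAreaSpace_dirichletW : IsAreaSpace dirichletW 0 where
  p_nonneg := le_rfl
  p_le_one := zero_le_one
  beta_zero := by simp [dirichletW]
  one_le n := by
    by_cases hn : n = 0
    · simp [dirichletW, hn]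
    · have : (1 : ℝ) ≤ n := by exact_mod_cast Nat.one_le_iff_ne_zero.2 hn
      simpa [dirichletW, hn] using this
  areaWeight_le n := by
    by_cases hn : n = 0
    · simp [dirichletW, hn, areaWeight]
    · have : (n : ℝ) ≠ 0 := by exact_mod_cast hn
      simp only [dirichletW, hn, areaWeight, if_false]
      rw [Real.sq_sqrt (by positivity)]
      field_simp
      simp
  le_areaWeight n hn := by
    have : (0 : ℝ) < n := by exact_mod_cast Nat.pos_of_ne_zero hn
    simp only [dirichletW, hn, areaWeight, if_false]
    rw [Real.sq_sqrt (by positivity)]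
    field_simp
    linarith

theorem areaWeight_nonneg {p : ℝ} (hp : p ≤ 1) (n : ℕ) : 0 ≤ areaWeight p n := by
  rcases Nat.eq_zero_or_pos n with rfl | hn
  · simp [areaWeight]
  · have h : (0 : ℝ) < n := by exact_mod_cast hn
    refine mul_nonneg (by positivity) ?_
    have h1 : ((n : ℝ) + 1)⁻¹ ≤ (n : ℝ)⁻¹ := inv_anti₀ h (by linarith)
    have h2 : (0 : ℝ) ≤ ((n : ℝ) + 1)⁻¹ := by positivity
    nlinarith

theorem enorm_sq_eq_ofReal {E : Type*} [SeminormedAddCommGroup E] (x : E) :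
    ‖x‖ₑ ^ 2 = ENNReal.ofReal (‖x‖ ^ 2) := by
  rw [← ofReal_norm, ENNReal.ofReal_pow (norm_nonneg _)]

namespace WH2

theorem enorm_sq (f : WH2) : ‖f‖ₑ ^ 2 = ∑' n, ‖f n‖ₑ ^ 2 := by
  have h := lp.norm_rpow_eq_tsum (p := 2) (by simp) f
  have hs := (lp.memℓp f).summable (p := 2) (by simp)
  simp only [ENNReal.toReal_ofNat, Real.rpow_ofNat] at h hs
  simp_rw [enorm_sq_eq_ofReal]
  rw [h, ENNReal.ofReal_tsum_of_nonneg (fun n => by positivity) hs]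

theorem norm_coord_le (f : WH2) (n : ℕ) : ‖f n‖ ≤ ‖f‖ := lp.norm_apply_le_norm (by simp) f n

/-- An element of `WH2` with given square-summable coordinates. -/
theorem exists_coord_eq {c : ℕ → ℂ} (hc : ∑' n, ‖c n‖ₑ ^ 2 ≠ ⊤) : ∃ f : WH2, ∀ n, f n = c n := by
  refine ⟨⟨c, memℓp_gen ?_⟩, fun n => rfl⟩
  simp only [ENNReal.toReal_ofNat, Real.rpow_ofNat]
  have := ENNReal.summable_toReal hc
  simpa using this

end WH2

noncomputable section

/-- The diagonal operator with contractive entries `d`, as a linear map. -/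
def diagLinearMap (d : ℕ → ℂ) (hd : ∀ n, ‖d n‖ ≤ 1) : WH2 →ₗ[ℂ] WH2 where
  toFun f := ⟨fun n => d n * f n, (lp.memℓp f).mono' (p := 2) fun n => by
    rw [norm_mul]; exact mul_le_of_le_one_left (norm_nonneg _) (hd n)⟩
  map_add' f g := by
    ext n
    exact mul_add _ _ _
  map_smul' c f := by
    ext n
    exact mul_left_comm _ _ _

theorem norm_diagLinearMap_apply_le (d : ℕ → ℂ) (hd : ∀ n, ‖d n‖ ≤ 1) (f : WH2) :
    ‖diagLinearMap d hd f‖ ≤ 1 * ‖f‖ := by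
  rw [one_mul]
  refine lp.norm_mono (p := 2) (by simp) fun n => ?_
  change ‖d n * f n‖ ≤ ‖f n‖
  rw [norm_mul]
  exact mul_le_of_le_one_left (norm_nonneg _) (hd n)

/-- The diagonal operator with contractive entries `d`. -/
def diagOp (d : ℕ → ℂ) (hd : ∀ n, ‖d n‖ ≤ 1) : WH2 →L[ℂ] WH2 :=
  (diagLinearMap d hd).mkContinuous 1 (norm_diagLinearMap_apply_le d hd)

end

@[simp]
theorem diagOp_apply (d : ℕ → ℂ) (hd : ∀ n, ‖d n‖ ≤ 1) (f : WH2) (n : ℕ) :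
    diagOp d hd f n = d n * f n := rfl

theorem norm_diagOp_apply_le (d : ℕ → ℂ) (hd : ∀ n, ‖d n‖ ≤ 1) (f : WH2) :
    ‖diagOp d hd f‖ ≤ ‖f‖ :=
  (norm_diagLinearMap_apply_le d hd f).trans_eq (one_mul _)

/-- Power series coefficients on the unit disc are determined by the sum. -/
theorem coeff_unique {a b : ℕ → ℂ} {F : ℂ → ℂ}
    (ha : ∀ z ∈ ball (0 : ℂ) 1, HasSum (fun n => a n * z ^ n) (F z))
    (hb : ∀ z ∈ ball (0 : ℂ) 1, HasSum (fun n => b n * z ^ n) (F z)) : a = b := by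
  have h : ∀ z ∈ ball (0 : ℂ) 1, HasSum (fun n => (a n - b n) * z ^ n) ((0 : ℂ → ℂ) z) := by
    intro z hz
    have := (ha z hz).sub (hb z hz)
    simpa [sub_mul] using this
  have h2 := lintegral_circle_sq h (r := 1 / 2) (by norm_num)
  simp only [Pi.zero_apply, enorm_zero, ne_eq, OfNat.ofNat_ne_zero, not_false_eq_true, zero_pow,
    lintegral_const, zero_mul] at h2
  have h3 : ENNReal.ofReal (2 * π) ≠ 0 := by simp [Real.pi_pos]
  have h4 := (mul_eq_zero.1 h2.symm).resolve_left h3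
  rw [ENNReal.tsum_eq_zero] at h4
  funext n
  have h5 := (mul_eq_zero.1 (h4 n)).resolve_right (by simp)
  simpa [sub_eq_zero] using h5

namespace IsAreaSpace

variable {β : ℕ → ℝ} {p : ℝ}

theorem beta_pos (h : IsAreaSpace β p) (n : ℕ) : 0 < β n := one_pos.trans_le (h.one_le n)

theorem norm_coeff_le (h : IsAreaSpace β p) (f : WH2) (n : ℕ) : ‖f n / (β n : ℂ)‖ ≤ ‖f‖ := by
  rw [norm_div, Complex.norm_real, Real.norm_of_nonneg (h.beta_pos n).le]
  exact (div_le_self (norm_nonneg _) (h.one_le n)).trans (f.norm_coord_le n)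

theorem norm_term_le (h : IsAreaSpace β p) (f : WH2) {r : ℝ} {z : ℂ} (hz : ‖z‖ ≤ r) (n : ℕ) :
    ‖f n / (β n : ℂ) * z ^ n‖ ≤ ‖f‖ * r ^ n := by
  rw [norm_mul, norm_pow]
  gcongr
  exact h.norm_coeff_le f n

theorem hasSum_wToFun (h : IsAreaSpace β p) (f : WH2) {z : ℂ} (hz : z ∈ ball (0 : ℂ) 1) :
    HasSum (fun n => f n / (β n : ℂ) * z ^ n) (wToFun β f z) := by
  refine (Summable.of_norm_bounded ?_ (h.norm_term_le f le_rfl)).hasSum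
  exact (summable_geometric_of_lt_one (norm_nonneg z) (by simpa using hz)).mul_left _

theorem norm_wToFun_le (h : IsAreaSpace β p) (f : WH2) {r : ℝ} (hr : r < 1) {z : ℂ}
    (hz : ‖z‖ ≤ r) : ‖wToFun β f z‖ ≤ ‖f‖ * (1 - r)⁻¹ :=
  tsum_of_norm_bounded
    ((hasSum_geometric_of_lt_one ((norm_nonneg z).trans hz) hr).mul_left _) (h.norm_term_le f hz)

theorem differentiableOn_wToFun (h : IsAreaSpace β p) (f : WH2) :
    DifferentiableOn ℂ (wToFun β f) (ball 0 1) := by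
  intro z hz
  obtain ⟨r, hzr, hr⟩ := exists_between (show ‖z‖ < 1 by simpa using hz)
  have h1 : DifferentiableOn ℂ (wToFun β f) (ball 0 r) :=
    differentiableOn_tsum_of_summable_norm (u := fun n => ‖f‖ * r ^ n)
      ((summable_geometric_of_lt_one ((norm_nonneg z).trans hzr.le) hr).mul_left _)
      (fun n => by fun_prop) isOpen_ball
      (fun n w hw => h.norm_term_le f (by simpa using (mem_ball_zero_iff.1 hw).le) n)
  exact (h1.differentiableAt (isOpen_ball.mem_nhds (by simpa using hzr))).differentiableWithinAt

theorem taylorCoeff_wToFun (h : IsAreaSpace β p) (f : WH2) (n : ℕ) :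
    taylorCoeff (wToFun β f) n = f n / (β n : ℂ) :=
  congrFun (coeff_unique (fun _ hz => hasSum_taylorCoeff (h.differentiableOn_wToFun f) hz)
    fun _ hz => h.hasSum_wToFun f hz) n

theorem wToFun_injective (h : IsAreaSpace β p) {f g : WH2}
    (hfg : ∀ z ∈ ball (0 : ℂ) 1, wToFun β f z = wToFun β g z) : f = g := by
  have := coeff_unique (fun _ hz => h.hasSum_wToFun f hz)
    (fun z hz => by rw [hfg z hz]; exact h.hasSum_wToFun g hz)
  ext n
  have h1 := congrFun this n
  have : (β n : ℂ) ≠ 0 := by exact_mod_cast (h.beta_pos n).ne'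
  exact (div_left_inj' this).1 h1

theorem wToFun_zero (h : IsAreaSpace β p) (f : WH2) : wToFun β f 0 = f 0 := by
  rw [wToFun, tsum_eq_single 0]
  · simp [h.beta_zero]
  · intro n hn
    simp [hn]

theorem wToFun_add (h : IsAreaSpace β p) (f g : WH2) {z : ℂ} (hz : z ∈ ball (0 : ℂ) 1) :
    wToFun β (f + g) z = wToFun β f z + wToFun β g z := by
  refine (h.hasSum_wToFun _ hz).unique ?_
  convert (h.hasSum_wToFun f hz).add (h.hasSum_wToFun g hz) using 2 with n
  rw [lp.coeFn_add, Pi.add_apply]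
  ring

theorem wToFun_smul (h : IsAreaSpace β p) (c : ℂ) (f : WH2) {z : ℂ} (hz : z ∈ ball (0 : ℂ) 1) :
    wToFun β (c • f) z = c * wToFun β f z := by
  refine (h.hasSum_wToFun _ hz).unique ?_
  have e : (fun n => (c • f : WH2) n / (β n : ℂ) * z ^ n) =
      fun n => c * (f n / (β n : ℂ) * z ^ n) := by
    funext n
    rw [lp.coeFn_smul, Pi.smul_apply, smul_eq_mul]
    ring
  rw [e]
  exact (h.hasSum_wToFun f hz).mul_left c

end IsAreaSpace

noncomputable section

/-- The ratio between the area norm and the coefficient norm on the `n`-th monomial. -/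
def areaScale (β : ℕ → ℝ) (p : ℝ) (n : ℕ) : ℝ :=
  if n = 0 then 1 else Real.sqrt (areaWeight p n) / β n

variable {β : ℕ → ℝ} {p : ℝ}

theorem IsAreaSpace.norm_areaScale_le (h : IsAreaSpace β p) (n : ℕ) :
    ‖(areaScale β p n : ℂ)‖ ≤ 1 := by
  rw [Complex.norm_real]
  by_cases hn : n = 0
  · simp [areaScale, hn]
  · simp only [areaScale, hn, if_false]
    rw [Real.norm_of_nonneg (div_nonneg (Real.sqrt_nonneg _) (h.beta_pos n).le),
      div_le_one (h.beta_pos n)]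
    exact (Real.sqrt_le_left (h.beta_pos n).le).2 (h.areaWeight_le n)

/-- The diagonal operator turning the coefficient norm into the area norm. -/
def IsAreaSpace.areaOp (h : IsAreaSpace β p) : WH2 →L[ℂ] WH2 :=
  diagOp (fun n => (areaScale β p n : ℂ)) h.norm_areaScale_le

end

namespace IsAreaSpace

variable {β : ℕ → ℝ} {p : ℝ}

theorem areaOp_apply_zero (h : IsAreaSpace β p) (f : WH2) : h.areaOp f 0 = f 0 := by
  simp [areaOp, areaScale]

theorem norm_sq_areaScale (h : IsAreaSpace β p) {n : ℕ} (hn : n ≠ 0) :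
    ‖(areaScale β p n : ℂ)‖ ^ 2 = areaWeight p n / β n ^ 2 := by
  rw [Complex.norm_real, Real.norm_eq_abs, sq_abs]
  simp only [areaScale, hn, if_false]
  rw [div_pow, Real.sq_sqrt (areaWeight_nonneg h.p_le_one n)]

theorem norm_areaOp_le (h : IsAreaSpace β p) (f : WH2) : ‖h.areaOp f‖ ≤ ‖f‖ :=
  norm_diagOp_apply_le _ _ f

theorem norm_sq_le_areaOp (h : IsAreaSpace β p) (f : WH2) : ‖f‖ ^ 2 ≤ 2 * ‖h.areaOp f‖ ^ 2 := by
  have h1 : ‖f‖ₑ ^ 2 ≤ ENNReal.ofReal 2 * ‖h.areaOp f‖ₑ ^ 2 := by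
    rw [f.enorm_sq, WH2.enorm_sq, ← ENNReal.tsum_mul_left]
    refine ENNReal.tsum_le_tsum fun n => ?_
    rw [enorm_sq_eq_ofReal, enorm_sq_eq_ofReal, ← ENNReal.ofReal_mul zero_le_two]
    refine ENNReal.ofReal_le_ofReal ?_
    rcases eq_or_ne n 0 with rfl | hn
    · rw [h.areaOp_apply_zero]
      nlinarith [sq_nonneg ‖f 0‖]
    · rw [areaOp, diagOp_apply, norm_mul, mul_pow, h.norm_sq_areaScale hn, ← mul_assoc]
      refine le_mul_of_one_le_left (by positivity) ?_
      have := h.beta_pos n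
      rw [mul_div_assoc', one_le_div (by positivity)]
      exact h.le_areaWeight n hn
  rw [enorm_sq_eq_ofReal, enorm_sq_eq_ofReal, ← ENNReal.ofReal_mul zero_le_two] at h1
  exact (ENNReal.ofReal_le_ofReal_iff (by positivity)).1 h1

theorem norm_sq_apply_zero_le (h : IsAreaSpace β p) (f : WH2) : ‖f 0‖ ^ 2 ≤ ‖h.areaOp f‖ ^ 2 := by
  have := (h.areaOp f).norm_coord_le 0
  rw [h.areaOp_apply_zero] at this
  gcongr

theorem areaEnergy_wToFun (h : IsAreaSpace β p) (f : WH2) :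
    areaEnergy p (wToFun β f) =
      ENNReal.ofReal π * ENNReal.ofReal (‖h.areaOp f‖ ^ 2 - ‖f 0‖ ^ 2) := by
  rw [areaEnergy_eq h.p_le_one (h.differentiableOn_wToFun f)]
  congr 1
  rw [ENNReal.ofReal_sub _ (by positivity), ← enorm_sq_eq_ofReal, ← enorm_sq_eq_ofReal,
    WH2.enorm_sq (h.areaOp f), tsum_eq_zero_add' ENNReal.summable,
    tsum_eq_zero_add' (f := fun n => ‖(h.areaOp f) n‖ₑ ^ 2) ENNReal.summable,
    h.areaOp_apply_zero, ENNReal.add_sub_cancel_left (by simp)]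
  simp only [areaWeight, Nat.cast_zero, ne_eq, OfNat.ofNat_ne_zero, not_false_eq_true, zero_pow,
    zero_mul, ENNReal.ofReal_zero, zero_add]
  congr 1 with n
  rw [h.taylorCoeff_wToFun, areaOp, diagOp_apply, enorm_sq_eq_ofReal, enorm_sq_eq_ofReal, norm_mul,
    mul_pow, h.norm_sq_areaScale n.succ_ne_zero, ← ENNReal.ofReal_mul]
  · rw [norm_div, Complex.norm_real, div_pow, Real.norm_eq_abs, sq_abs, areaWeight]
    congr 1
    ring
  · exact areaWeight_nonneg h.p_le_one (n + 1)

/-- A holomorphic function of finite area energy belongs to the space. -/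
theorem exists_wToFun_eq (h : IsAreaSpace β p) {F : ℂ → ℂ} (hF : DifferentiableOn ℂ F (ball 0 1))
    (hE : areaEnergy p F ≠ ⊤) : ∃ g : WH2, ∀ z ∈ ball (0 : ℂ) 1, wToFun β g z = F z := by
  rw [areaEnergy_eq h.p_le_one hF] at hE
  have hE' : ∑' n, ENNReal.ofReal (areaWeight p n) * ‖taylorCoeff F n‖ₑ ^ 2 ≠ ⊤ := by
    intro hcon
    rw [hcon, ENNReal.mul_top (by simp [Real.pi_pos])] at hE
    exact hE rfl
  have hfin : ∑' n, ‖taylorCoeff F n * (β n : ℂ)‖ₑ ^ 2 ≠ ⊤ := by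
    rw [tsum_eq_zero_add' ENNReal.summable]
    refine ENNReal.add_ne_top.2 ⟨by finiteness, ?_⟩
    refine ne_top_of_le_ne_top (ENNReal.mul_ne_top (ENNReal.ofReal_ne_top (r := 2)) hE') ?_
    rw [tsum_eq_zero_add' (f := fun n => ENNReal.ofReal (areaWeight p n) * ‖taylorCoeff F n‖ₑ ^ 2)
      ENNReal.summable, mul_add, ← ENNReal.tsum_mul_left]
    refine le_add_left (ENNReal.tsum_le_tsum fun n => ?_)
    have h0 := areaWeight_nonneg h.p_le_one (n + 1)
    rw [enorm_sq_eq_ofReal, enorm_sq_eq_ofReal, ← ENNReal.ofReal_mul h0,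
      ← ENNReal.ofReal_mul zero_le_two]
    refine ENNReal.ofReal_le_ofReal ?_
    rw [norm_mul, mul_pow, Complex.norm_real, Real.norm_eq_abs, sq_abs, ← mul_assoc, mul_comm]
    gcongr
    exact h.le_areaWeight (n + 1) n.succ_ne_zero
  obtain ⟨g, hg⟩ := WH2.exists_coord_eq hfin
  refine ⟨g, fun z hz => ?_⟩
  rw [wToFun, ← (hasSum_taylorCoeff hF hz).tsum_eq]
  congr 1 with n
  have : (β n : ℂ) ≠ 0 := by exact_mod_cast (h.beta_pos n).ne'
  rw [hg, mul_div_cancel_right₀ _ this]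

end IsAreaSpace

theorem abs_det_restrictScalars_toSpanSingleton (c : ℂ) :
    |(((ContinuousLinearMap.toSpanSingleton ℂ c).restrictScalars ℝ : ℂ →L[ℝ] ℂ)).det| =
      ‖c‖ ^ 2 := by
  have : (((ContinuousLinearMap.toSpanSingleton ℂ c).restrictScalars ℝ : ℂ →L[ℝ] ℂ)).det =
      Algebra.norm ℝ (LinearMap.det (ContinuousLinearMap.toSpanSingleton ℂ c : ℂ →ₗ[ℂ] ℂ)) :=
    LinearMap.det_restrictScalars
  rw [this, LinearMap.det_ring, Algebra.norm_complex_apply]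
  simp [Complex.normSq_eq_norm_sq]

/-- Change of variables for injective holomorphic maps of the disc. -/
theorem areaEnergy_comp_le {p C : ℝ} (hp0 : 0 ≤ p) (hp1 : p ≤ 1) (hC : 1 ≤ C) {ψ F : ℂ → ℂ}
    (hψ : DifferentiableOn ℂ ψ (ball 0 1)) (hmaps : MapsTo ψ (ball 0 1) (ball 0 1))
    (hinj : InjOn ψ (ball 0 1))
    (hle : ∀ z ∈ ball (0 : ℂ) 1, 1 - ‖z‖ ^ 2 ≤ C * (1 - ‖ψ z‖ ^ 2))
    (hF : DifferentiableOn ℂ F (ball 0 1)) :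
    areaEnergy p (F ∘ ψ) ≤ ENNReal.ofReal C * areaEnergy p F := by
  have hderiv : ∀ z ∈ ball (0 : ℂ) 1, HasFDerivWithinAt ψ
      ((ContinuousLinearMap.toSpanSingleton ℂ (deriv ψ z)).restrictScalars ℝ : ℂ →L[ℝ] ℂ)
      (ball 0 1) z := fun z hz =>
    ((hψ.differentiableAt (isOpen_ball.mem_nhds hz)).hasDerivAt.hasFDerivAt.restrictScalars
      ℝ).hasFDerivWithinAt
  have hcv := lintegral_image_eq_lintegral_abs_det_fderiv_mul volume measurableSet_ball hderiv hinj
    (fun w => ‖deriv F w‖ₑ ^ 2 * ENNReal.ofReal (1 - p * ‖w‖ ^ 2))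
  calc areaEnergy p (F ∘ ψ)
      ≤ ∫⁻ z in ball (0 : ℂ) 1, ENNReal.ofReal C *
          (ENNReal.ofReal |(((ContinuousLinearMap.toSpanSingleton ℂ
            (deriv ψ z)).restrictScalars ℝ : ℂ →L[ℝ] ℂ)).det| *
          (‖deriv F (ψ z)‖ₑ ^ 2 * ENNReal.ofReal (1 - p * ‖ψ z‖ ^ 2))) := by
        refine setLIntegral_mono' measurableSet_ball fun z hz => ?_
        rw [abs_det_restrictScalars_toSpanSingleton, deriv_comp z
          (hF.differentiableAt (isOpen_ball.mem_nhds (hmaps hz)))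
          (hψ.differentiableAt (isOpen_ball.mem_nhds hz)), enorm_mul, mul_pow,
          ← enorm_sq_eq_ofReal]
        have h1 : ENNReal.ofReal (1 - p * ‖z‖ ^ 2) ≤
            ENNReal.ofReal C * ENNReal.ofReal (1 - p * ‖ψ z‖ ^ 2) := by
          rw [← ENNReal.ofReal_mul (by linarith)]
          refine ENNReal.ofReal_le_ofReal ?_
          have := hle z hz
          nlinarith
        calc _ ≤ ‖deriv F (ψ z)‖ₑ ^ 2 * ‖deriv ψ z‖ₑ ^ 2 *
              (ENNReal.ofReal C * ENNReal.ofReal (1 - p * ‖ψ z‖ ^ 2)) := by gcongr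
          _ = _ := by ring
    _ = ENNReal.ofReal C * ∫⁻ w in ψ '' ball 0 1,
          ‖deriv F w‖ₑ ^ 2 * ENNReal.ofReal (1 - p * ‖w‖ ^ 2) := by
        rw [hcv, lintegral_const_mul' _ _ ENNReal.ofReal_ne_top]
    _ ≤ ENNReal.ofReal C * areaEnergy p F := by
        gcongr
        exact lintegral_mono_set (image_subset_iff.2 hmaps)

namespace IsAreaSpace

variable {β : ℕ → ℝ} {p : ℝ}

theorem exists_comp_eq (h : IsAreaSpace β p) {C : ℝ} (hC : 1 ≤ C) {ψ : ℂ → ℂ}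
    (hψ : DifferentiableOn ℂ ψ (ball 0 1)) (hmaps : MapsTo ψ (ball 0 1) (ball 0 1))
    (hinj : InjOn ψ (ball 0 1))
    (hle : ∀ z ∈ ball (0 : ℂ) 1, 1 - ‖z‖ ^ 2 ≤ C * (1 - ‖ψ z‖ ^ 2)) (f : WH2) :
    ∃ g : WH2, (∀ z ∈ ball (0 : ℂ) 1, wToFun β g z = wToFun β f (ψ z)) ∧
      ‖h.areaOp g‖ ^ 2 ≤ ‖wToFun β f (ψ 0)‖ ^ 2 + C * (‖h.areaOp f‖ ^ 2 - ‖f 0‖ ^ 2) := by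
  have hC0 : 0 ≤ C := zero_le_one.trans hC
  have hE := areaEnergy_comp_le h.p_nonneg h.p_le_one hC hψ hmaps hinj hle
    (h.differentiableOn_wToFun f)
  rw [h.areaEnergy_wToFun] at hE
  obtain ⟨g, hg⟩ := h.exists_wToFun_eq ((h.differentiableOn_wToFun f).comp hψ hmaps)
    (ne_top_of_le_ne_top (by finiteness) hE)
  refine ⟨g, hg, ?_⟩
  have hEg : areaEnergy p (wToFun β g) = areaEnergy p (wToFun β f ∘ ψ) := by
    refine setLIntegral_congr_fun measurableSet_ball fun z hz => ?_
    have : wToFun β g =ᶠ[𝓝 z] wToFun β f ∘ ψ := by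
      filter_upwards [isOpen_ball.mem_nhds hz] with w hw using hg w hw
    rw [this.deriv_eq]
  rw [← hEg, h.areaEnergy_wToFun, ← ENNReal.ofReal_mul Real.pi_pos.le,
    ← ENNReal.ofReal_mul Real.pi_pos.le, ← ENNReal.ofReal_mul hC0] at hE
  have hnn := sub_nonneg.2 (h.norm_sq_apply_zero_le f)
  have hE2 := (ENNReal.ofReal_le_ofReal_iff
    (mul_nonneg hC0 (mul_nonneg Real.pi_pos.le hnn))).1 hE
  have hE3 : ‖h.areaOp g‖ ^ 2 - ‖g 0‖ ^ 2 ≤ C * (‖h.areaOp f‖ ^ 2 - ‖f 0‖ ^ 2) := by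
    refine le_of_mul_le_mul_left ?_ Real.pi_pos
    linarith
  have hg0 : g 0 = wToFun β f (ψ 0) := by
    rw [← h.wToFun_zero, hg 0 (by simp)]
    rfl
  rw [← hg0]
  linarith

/-- Injective self-maps that do not move points too close to the boundary induce bounded
composition operators. -/
theorem exists_compOp (h : IsAreaSpace β p) {C : ℝ} (hC : 1 ≤ C) {ψ : ℂ → ℂ}
    (hψ : DifferentiableOn ℂ ψ (ball 0 1)) (hmaps : MapsTo ψ (ball 0 1) (ball 0 1))
    (hinj : InjOn ψ (ball 0 1))
    (hle : ∀ z ∈ ball (0 : ℂ) 1, 1 - ‖z‖ ^ 2 ≤ C * (1 - ‖ψ z‖ ^ 2)) :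
    ∃ T : WH2 →L[ℂ] WH2, RepresentsComp β T ψ := by
  choose g hg hg' using h.exists_comp_eq hC hψ hmaps hinj hle
  have hC0 : 0 ≤ C := zero_le_one.trans hC
  have hψ0 : ‖ψ 0‖ < 1 := by simpa using hmaps (mem_ball_self one_pos)
  let L : WH2 →ₗ[ℂ] WH2 :=
    { toFun := g
      map_add' := fun f₁ f₂ => h.wToFun_injective fun z hz => by
        rw [hg _ _ hz, h.wToFun_add _ _ (hmaps hz), h.wToFun_add _ _ hz, hg _ _ hz, hg _ _ hz]
      map_smul' := fun c f => h.wToFun_injective fun z hz => by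
        rw [hg _ _ hz, h.wToFun_smul _ _ (hmaps hz), RingHom.id_apply, h.wToFun_smul _ _ hz,
          hg _ _ hz] }
  set K : ℝ := 2 * ((1 - ‖ψ 0‖)⁻¹ ^ 2 + C)
  refine ⟨L.mkContinuous (Real.sqrt K) fun f => ?_, hψ, hmaps, fun f z hz => hg f z hz⟩
  have key : ‖g f‖ ^ 2 ≤ K * ‖f‖ ^ 2 := by
    have h1 := h.norm_sq_le_areaOp (g f)
    have h2 := hg' f
    have h3 : ‖wToFun β f (ψ 0)‖ ^ 2 ≤ (‖f‖ * (1 - ‖ψ 0‖)⁻¹) ^ 2 := by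
      gcongr
      exact h.norm_wToFun_le f hψ0 le_rfl
    have h4 : ‖h.areaOp f‖ ^ 2 - ‖f 0‖ ^ 2 ≤ ‖f‖ ^ 2 := by
      have : ‖h.areaOp f‖ ^ 2 ≤ ‖f‖ ^ 2 := by
        gcongr
        exact h.norm_areaOp_le f
      nlinarith [sq_nonneg ‖f 0‖]
    have h5 := mul_le_mul_of_nonneg_left h4 hC0
    calc ‖g f‖ ^ 2 ≤ 2 * ((‖f‖ * (1 - ‖ψ 0‖)⁻¹) ^ 2 + C * ‖f‖ ^ 2) := by linarith
      _ = K * ‖f‖ ^ 2 := by ring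
  calc ‖L f‖ ≤ Real.sqrt (K * ‖f‖ ^ 2) := Real.le_sqrt_of_sq_le key
    _ = Real.sqrt K * ‖f‖ := by
      rw [Real.sqrt_mul (by positivity), Real.sqrt_sq (norm_nonneg _)]

theorem norm_sq_areaOp_comp_le (h : IsAreaSpace β p) {C : ℝ} (hC : 1 ≤ C) {ψ : ℂ → ℂ}
    (hinj : InjOn ψ (ball 0 1))
    (hle : ∀ z ∈ ball (0 : ℂ) 1, 1 - ‖z‖ ^ 2 ≤ C * (1 - ‖ψ z‖ ^ 2)) {T : WH2 →L[ℂ] WH2}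
    (hT : RepresentsComp β T ψ) (f : WH2) :
    ‖h.areaOp (T f)‖ ^ 2 ≤
      ‖wToFun β f (ψ 0)‖ ^ 2 + C * (‖h.areaOp f‖ ^ 2 - ‖f 0‖ ^ 2) := by
  obtain ⟨g, hg, hg'⟩ := h.exists_comp_eq hC hT.1 hT.2.1 hinj hle f
  rwa [h.wToFun_injective fun z hz => (hT.2.2 f z hz).trans (hg z hz).symm]

end IsAreaSpace

/-- A semiflow of the unit disc whose generator points strictly inwards on the annulus
`ρ < |z| < 1`. -/
structure IsInwardFlow (φ : ℝ → ℂ → ℂ) (G : ℂ → ℂ) (δ ρ : ℝ) : Prop where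
  flow : IsSemiflow φ
  gen : SemiflowGenerator φ G
  diff : DifferentiableOn ℂ G (ball 0 1)
  delta_pos : 0 < δ
  rho_pos : 0 < ρ
  rho_lt_one : ρ < 1
  inward : ∀ z : ℂ, ρ < ‖z‖ → ‖z‖ < 1 → ((starRingEnd ℂ) z * G z).re ≤ -δ

namespace IsInwardFlow

variable {φ : ℝ → ℂ → ℂ} {G : ℂ → ℂ} {δ ρ : ℝ} {s t : ℝ} {z : ℂ}

theorem mem_ball (h : IsInwardFlow φ G δ ρ) (ht : 0 ≤ t) (hz : z ∈ ball (0 : ℂ) 1) :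
    φ t z ∈ ball (0 : ℂ) 1 :=
  (h.flow.2.1 t ht).2 hz

theorem norm_lt_one (h : IsInwardFlow φ G δ ρ) (ht : 0 ≤ t) (hz : z ∈ ball (0 : ℂ) 1) :
    ‖φ t z‖ < 1 := by
  simpa using h.mem_ball ht hz

theorem hasDerivAt_norm_sq (h : IsInwardFlow φ G δ ρ) (ht : 0 ≤ t) (hz : z ∈ ball (0 : ℂ) 1) :
    HasDerivAt (fun s => ‖φ s z‖ ^ 2) (2 * ((starRingEnd ℂ) (φ t z) * G (φ t z)).re) t := by
  have := (h.gen z hz t ht).norm_sq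
  rwa [Complex.inner, mul_comm (G _)] at this

theorem continuousOn_norm_sq (h : IsInwardFlow φ G δ ρ) (hz : z ∈ ball (0 : ℂ) 1) :
    ContinuousOn (fun s => ‖φ s z‖ ^ 2) (Ici 0) := fun _ ht =>
  (h.hasDerivAt_norm_sq ht hz).continuousAt.continuousWithinAt

theorem norm_sq_le_of_norm_sq_le (h : IsInwardFlow φ G δ ρ) (hz : z ∈ ball (0 : ℂ) 1) {B : ℝ}
    (hB : ρ ^ 2 < B) (hs : 0 ≤ s) (hst : s ≤ t) (hsB : ‖φ s z‖ ^ 2 ≤ B) : ‖φ t z‖ ^ 2 ≤ B := by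
  refine image_le_of_deriv_right_lt_deriv_boundary' (B := fun _ => B) (B' := fun _ => 0)
    ((h.continuousOn_norm_sq hz).mono fun x hx => hs.trans hx.1)
    (fun x hx => (h.hasDerivAt_norm_sq (hs.trans hx.1) hz).hasDerivWithinAt) hsB continuousOn_const
    (fun x _ => hasDerivWithinAt_const _ _ _) (fun x hx hxB => ?_) ⟨hst, le_rfl⟩
  have hx0 : 0 ≤ x := hs.trans hx.1
  have := h.inward (φ x z) (lt_of_pow_lt_pow_left₀ 2 (norm_nonneg _) (by rwa [hxB]))
    (h.norm_lt_one hx0 hz)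
  linarith [h.delta_pos]

theorem norm_sq_sub_le (h : IsInwardFlow φ G δ ρ) (hz : z ∈ ball (0 : ℂ) 1) (ht : 0 ≤ t) {M : ℝ}
    (hM : ∀ s ∈ Ioo 0 t, 2 * ((starRingEnd ℂ) (φ s z) * G (φ s z)).re ≤ M) :
    ‖φ t z‖ ^ 2 - ‖z‖ ^ 2 ≤ M * t := by
  have := (convex_Icc 0 t).image_sub_le_mul_sub_of_deriv_le
    ((h.continuousOn_norm_sq hz).mono fun x hx => hx.1)
    (fun x hx => by
      rw [interior_Icc] at hx
      exact (h.hasDerivAt_norm_sq hx.1.le hz).differentiableAt.differentiableWithinAt)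
    (C := M) (fun x hx => by
      rw [interior_Icc] at hx
      rw [(h.hasDerivAt_norm_sq hx.1.le hz).deriv]
      exact hM x hx) 0 ⟨le_rfl, ht⟩ t ⟨ht, le_rfl⟩ ht
  rwa [h.flow.1 z hz, sub_zero] at this

theorem norm_sq_le (h : IsInwardFlow φ G δ ρ) (hz : z ∈ ball (0 : ℂ) 1) (ht : 0 ≤ t) :
    ‖φ t z‖ ^ 2 ≤ max (‖z‖ ^ 2 - 2 * δ * t) (ρ ^ 2) := by
  by_contra! hcon
  obtain ⟨h1, h2⟩ := max_lt_iff.1 hcon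
  obtain ⟨B, hB, hBt⟩ := exists_between h2
  have := h.norm_sq_sub_le hz ht (M := -(2 * δ)) fun s hs => by
    have h3 : ρ < ‖φ s z‖ := by
      refine lt_of_pow_lt_pow_left₀ 2 (norm_nonneg _) ?_
      by_contra! h4
      exact (h.norm_sq_le_of_norm_sq_le hz hB hs.1.le hs.2.le (h4.trans hB.le)).not_gt hBt
    linarith [h.inward (φ s z) h3 (h.norm_lt_one hs.1.le hz)]
  linarith

theorem norm_sq_le' (h : IsInwardFlow φ G δ ρ) (hz : z ∈ ball (0 : ℂ) 1) (ht : 0 ≤ t) :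
    ‖φ t z‖ ^ 2 ≤ max (‖z‖ ^ 2) (ρ ^ 2) := by
  refine (h.norm_sq_le hz ht).trans (max_le_max_right _ ?_)
  have := mul_nonneg h.delta_pos.le ht
  linarith

theorem norm_le (h : IsInwardFlow φ G δ ρ) (hz : z ∈ ball (0 : ℂ) 1) (ht : 0 ≤ t) :
    ‖φ t z‖ ≤ max ‖z‖ ρ := by
  rcases le_max_iff.1 (h.norm_sq_le' hz ht) with h1 | h1
  · exact le_max_of_le_left (le_of_sq_le_sq h1 (norm_nonneg _))
  · exact le_max_of_le_right (le_of_sq_le_sq h1 h.rho_pos.le)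

theorem norm_zero_le (h : IsInwardFlow φ G δ ρ) (ht : 0 ≤ t) : ‖φ t 0‖ ≤ ρ := by
  simpa [h.rho_pos.le] using h.norm_le (mem_ball_self one_pos) ht

theorem one_sub_rho_sq_pos (h : IsInwardFlow φ G δ ρ) : 0 < 1 - ρ ^ 2 := by
  nlinarith [h.rho_pos, h.rho_lt_one]

/-- The flow does not move points much closer to the boundary, uniformly in time. -/
theorem one_sub_norm_sq_le (h : IsInwardFlow φ G δ ρ) (ht : 0 ≤ t) (hz : z ∈ ball (0 : ℂ) 1) :
    1 - ‖z‖ ^ 2 ≤ (1 - ρ ^ 2)⁻¹ * (1 - ‖φ t z‖ ^ 2) := by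
  have h0 := h.one_sub_rho_sq_pos
  rw [inv_mul_eq_div, le_div_iff₀ h0]
  have hz1 : ‖z‖ ^ 2 < 1 := by
    have : ‖z‖ < 1 := by simpa using hz
    nlinarith [norm_nonneg z]
  rcases le_max_iff.1 (h.norm_sq_le' hz ht) with h1 | h1
  · nlinarith [sq_nonneg ρ]
  · nlinarith [sq_nonneg ‖z‖]

/-- For small times, the constant in `one_sub_norm_sq_le` is close to `1`. -/
theorem exists_one_sub_norm_sq_le (h : IsInwardFlow φ G δ ρ) : ∃ M : ℝ, 0 ≤ M ∧ ∀ t : ℝ, 0 ≤ t →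
    ∀ z ∈ ball (0 : ℂ) 1, 1 - ‖z‖ ^ 2 ≤ (1 + M * t) * (1 - ‖φ t z‖ ^ 2) := by
  have h0 := h.one_sub_rho_sq_pos
  obtain ⟨K, hK⟩ := (isCompact_closedBall (0 : ℂ) ρ).exists_bound_of_continuousOn
    (h.diff.continuousOn.mono (closedBall_subset_ball h.rho_lt_one))
  have hK0 : 0 ≤ K := (norm_nonneg _).trans (hK 0 (by simp [h.rho_pos.le]))
  refine ⟨2 * K * (1 - ρ ^ 2)⁻¹, by positivity, fun t ht z hz => ?_⟩
  have hφ1 : ‖φ t z‖ ^ 2 < 1 := by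
    have := h.norm_lt_one ht hz
    nlinarith [norm_nonneg (φ t z)]
  rcases le_or_gt ‖z‖ ρ with hzρ | hzρ
  · have hs : ∀ s, 0 ≤ s → ‖φ s z‖ ≤ ρ := fun s hs =>
      (h.norm_le hz hs).trans (max_le hzρ le_rfl)
    have h1 := h.norm_sq_sub_le hz ht (M := 2 * K) fun s hs' => by
      have h2 := hs s hs'.1.le
      have h3 : ‖G (φ s z)‖ ≤ K := hK _ (by simpa using h2)
      have h4 := Complex.re_le_norm ((starRingEnd ℂ) (φ s z) * G (φ s z))
      rw [norm_mul, RCLike.norm_conj] at h4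
      nlinarith [norm_nonneg (G (φ s z)), norm_nonneg (φ s z), h.rho_lt_one]
    have h2 : 1 - ρ ^ 2 ≤ 1 - ‖φ t z‖ ^ 2 := by
      have := hs t ht
      nlinarith [norm_nonneg (φ t z)]
    have h3 : 1 ≤ (1 - ρ ^ 2)⁻¹ * (1 - ‖φ t z‖ ^ 2) := by
      rwa [inv_mul_eq_div, le_div_iff₀ h0, one_mul]
    have h4 := mul_le_mul_of_nonneg_left h3 (mul_nonneg (mul_nonneg zero_le_two hK0) ht)
    linarith
  · have h1 := h.norm_sq_le' hz ht
    rw [max_eq_left (pow_le_pow_left₀ h.rho_pos.le hzρ.le 2)] at h1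
    have : 0 ≤ 2 * K * (1 - ρ ^ 2)⁻¹ * t * (1 - ‖φ t z‖ ^ 2) :=
      mul_nonneg (by positivity) (by linarith)
    linarith

/-- At positive times the flow maps the disc into a smaller disc. -/
theorem exists_norm_le (h : IsInwardFlow φ G δ ρ) (ht : 0 < t) :
    ∃ r : ℝ, 0 < r ∧ r < 1 ∧ ∀ z ∈ ball (0 : ℂ) 1, ‖φ t z‖ ≤ r := by
  have h0 := h.one_sub_rho_sq_pos
  have hm : max (1 - 2 * δ * t) (ρ ^ 2) < 1 :=
    max_lt (by have := mul_pos h.delta_pos ht; linarith) (by linarith)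
  refine ⟨Real.sqrt (max (1 - 2 * δ * t) (ρ ^ 2)),
    Real.sqrt_pos.2 (lt_max_of_lt_right (pow_pos h.rho_pos 2)),
    by rw [Real.sqrt_lt' one_pos]; simpa using hm, fun z hz => Real.le_sqrt_of_sq_le ?_⟩
  refine (h.norm_sq_le hz ht.le).trans (max_le_max_right _ ?_)
  have : ‖z‖ < 1 := by simpa using hz
  nlinarith [norm_nonneg z]

theorem injOn (h : IsInwardFlow φ G δ ρ) (ht : 0 ≤ t) : InjOn (φ t) (ball 0 1) := by
  intro z hz w hw hzw
  have hz1 : ‖z‖ < 1 := by simpa using hz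
  have hw1 : ‖w‖ < 1 := by simpa using hw
  set R := max (max ‖z‖ ‖w‖) ρ
  have hR : R < 1 := max_lt (max_lt hz1 hw1) h.rho_lt_one
  have hsub : closedBall (0 : ℂ) R ⊆ ball 0 1 := closedBall_subset_ball hR
  obtain ⟨K, hK⟩ := (isCompact_closedBall (0 : ℂ) R).exists_bound_of_continuousOn
    ((h.diff.deriv isOpen_ball).continuousOn.mono hsub)
  have hL : LipschitzOnWith K.toNNReal G (closedBall 0 R) :=
    Convex.lipschitzOnWith_of_nnnorm_deriv_le
      (fun x hx => h.diff.differentiableAt (isOpen_ball.mem_nhds (hsub hx)))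
      (fun x hx => by
        rw [← NNReal.coe_le_coe, coe_nnnorm]
        exact (hK x hx).trans (Real.le_coe_toNNReal K)) (convex_closedBall _ _)
  have hflow : ∀ x ∈ ball (0 : ℂ) 1, ContinuousOn (fun s => φ s x) (Icc 0 t) := fun x hx s hs =>
    (h.gen x hx s hs.1).continuousAt.continuousWithinAt
  have key := ODE_solution_unique_of_mem_Icc_left (v := fun _ => G) (s := fun _ => closedBall 0 R)
    (f := fun s => φ s z) (g := fun s => φ s w) (a := 0) (b := t)
    (fun _ _ => hL) (hflow z hz) (fun s hs => (h.gen z hz s hs.1.le).hasDerivWithinAt)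
    (fun s hs => by
      exact mem_closedBall_zero_iff.2 ((h.norm_le hz hs.1.le).trans
        (max_le_max_right ρ (le_max_left ‖z‖ ‖w‖))))
    (hflow w hw) (fun s hs => (h.gen w hw s hs.1.le).hasDerivWithinAt)
    (fun s hs => by
      exact mem_closedBall_zero_iff.2 ((h.norm_le hw hs.1.le).trans
        (max_le_max_right ρ (le_max_right ‖z‖ ‖w‖))))
    hzw (left_mem_Icc.2 ht)
  simpa [h.flow.1 z hz, h.flow.1 w hw] using key

/-- A uniform bound for small times. -/
theorem exists_norm_le_max (h : IsInwardFlow φ G δ ρ) : ∃ t₀ : ℝ, 0 < t₀ ∧ ∃ M : ℝ, 0 < M ∧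
    ∀ t : ℝ, 0 < t → t ≤ t₀ →
      (∀ z ∈ ball (0 : ℂ) 1, ‖φ t z‖ ≤
        max (Real.sqrt (1 - 2 * δ * t)) (Real.sqrt (ρ ^ 2 + t₀ * M))) ∧
      max (Real.sqrt (1 - 2 * δ * t)) (Real.sqrt (ρ ^ 2 + t₀ * M)) < 1 := by
  have h0 := h.one_sub_rho_sq_pos
  refine ⟨(1 - ρ ^ 2) / 2, by positivity, 1, one_pos, fun t ht _ => ⟨fun z hz => ?_, ?_⟩⟩
  · rcases le_max_iff.1 (h.norm_sq_le hz ht.le) with h1 | h1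
    · refine le_max_of_le_left (Real.le_sqrt_of_sq_le (h1.trans ?_))
      have : ‖z‖ < 1 := by simpa using hz
      nlinarith [norm_nonneg z]
    · exact le_max_of_le_right (Real.le_sqrt_of_sq_le (h1.trans (by linarith)))
  · have := mul_pos h.delta_pos ht
    rw [max_lt_iff, Real.sqrt_lt' one_pos, Real.sqrt_lt' one_pos]
    constructor <;> linarith

end IsInwardFlow

theorem lt_one_of_inward {G : ℂ → ℂ} (hG : ContinuousAt G 0) {δ ε : ℝ} (hδ : 0 < δ)
    (hbd : ∀ z : ℂ, 1 - ε < ‖z‖ → ‖z‖ < 1 → ((starRingEnd ℂ) z * G z).re ≤ -δ) : ε < 1 := by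
  by_contra! hε
  have hc : ContinuousAt (fun z => ((starRingEnd ℂ) z * G z).re) 0 :=
    Complex.continuous_re.continuousAt.comp (Complex.continuous_conj.continuousAt.mul hG)
  have hle : ∀ᶠ z in 𝓝[≠] (0 : ℂ), ((starRingEnd ℂ) z * G z).re ≤ -δ := by
    filter_upwards [self_mem_nhdsWithin, nhdsWithin_le_nhds (ball_mem_nhds (0 : ℂ) one_pos)]
      with z hz0 hz1
    refine hbd z ?_ (by simpa using hz1)
    linarith [norm_pos_iff.2 hz0]
  have := le_of_tendsto (hc.tendsto.mono_left nhdsWithin_le_nhds) hle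
  simp only [map_zero, zero_mul, Complex.zero_re] at this
  linarith

/-- In `ℓ²`, coordinatewise convergence together with convergence of upper bounds for the norms
implies norm convergence. -/
theorem WH2.tendsto_of_coord {ι : Type*} {l : Filter ι} {y : ι → WH2} {x : WH2} {b : ι → ℝ}
    (hy : ∀ n, Tendsto (fun i => y i n) l (𝓝 (x n))) (hb : Tendsto b l (𝓝 (‖x‖ ^ 2)))
    (hle : ∀ᶠ i in l, ‖y i‖ ^ 2 ≤ b i) : Tendsto y l (𝓝 x) := by
  have hsum : HasSum (fun n => ‖x n‖ ^ 2) (‖x‖ ^ 2) := by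
    have h := lp.norm_rpow_eq_tsum (p := 2) (by simp) x
    have hs := (lp.memℓp x).summable (p := 2) (by simp)
    simp only [ENNReal.toReal_ofNat, Real.rpow_ofNat] at h hs
    rw [h]
    exact hs.hasSum
  have hfin (N : Finset ℕ) (w : WH2) : ∑ n ∈ N, ‖w n‖ ^ 2 ≤ ‖w‖ ^ 2 := by
    have := lp.sum_rpow_le_norm_rpow (p := 2) (by simp) w N
    simpa only [ENNReal.toReal_ofNat, Real.rpow_ofNat] using this
  rw [tendsto_iff_norm_sub_tendsto_zero]
  have hsq : Tendsto (fun i => ‖y i - x‖ ^ 2) l (𝓝 0) := by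
    rw [tendsto_order]
    refine ⟨fun e he => Eventually.of_forall fun i => he.trans_le (by positivity), fun e he => ?_⟩
    obtain ⟨N, hN⟩ := (hsum.eventually_const_lt
      (show ‖x‖ ^ 2 - e / 4 < ‖x‖ ^ 2 by linarith)).exists
    have hlim : Tendsto (fun i => 2 * b i + 2 * ‖x‖ ^ 2 - ∑ n ∈ N, ‖y i n + x n‖ ^ 2) l
        (𝓝 (2 * ‖x‖ ^ 2 + 2 * ‖x‖ ^ 2 - ∑ n ∈ N, ‖x n + x n‖ ^ 2)) :=
      ((hb.const_mul 2).add_const _).sub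
        (tendsto_finsetSum _ fun n _ => (((hy n).add_const _).norm.pow 2))
    have hval : ∑ n ∈ N, ‖x n + x n‖ ^ 2 = 4 * ∑ n ∈ N, ‖x n‖ ^ 2 := by
      rw [Finset.mul_sum]
      refine Finset.sum_congr rfl fun n _ => ?_
      rw [← two_mul, norm_mul]
      norm_num
      ring
    filter_upwards [hlim.eventually_lt_const (show _ < e by rw [hval]; linarith), hle]
      with i hi hi'
    have h1 := parallelogram_law_with_norm ℂ (y i) x
    have h2 := hfin N (y i + x)
    simp only [lp.coeFn_add, Pi.add_apply] at h2
    nlinarith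
  have := hsq.sqrt
  simpa [Real.sqrt_sq (norm_nonneg _)] using this

namespace IsAreaSpace

variable {β : ℕ → ℝ} {p : ℝ}

theorem wToFun_sub (h : IsAreaSpace β p) (f g : WH2) {z : ℂ} (hz : z ∈ ball (0 : ℂ) 1) :
    wToFun β (f - g) z = wToFun β f z - wToFun β g z := by
  rw [eq_sub_iff_add_eq, ← h.wToFun_add _ _ hz, sub_add_cancel]

/-- Bounded pointwise convergence on the disc implies convergence of the coordinates. -/
theorem tendsto_coord (h : IsAreaSpace β p) {ι : Type*} {l : Filter ι} [l.IsCountablyGenerated]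
    {y : ι → WH2} {x : WH2} {K : ℝ} (hK : ∀ᶠ i in l, ‖y i‖ ≤ K)
    (hy : ∀ z ∈ ball (0 : ℂ) 1, Tendsto (fun i => wToFun β (y i) z) l (𝓝 (wToFun β x z))) (n : ℕ) :
    Tendsto (fun i => y i n) l (𝓝 (x n)) := by
  have hr : (2⁻¹ : ℝ) ∈ Ioo (0 : ℝ) 1 := by constructor <;> norm_num
  have hmem (θ : ℝ) : ((2⁻¹ : ℝ) : ℂ) * cexp (θ * I) ∈ ball (0 : ℂ) 1 := by
    rw [mem_ball_zero_iff, norm_mul, Complex.norm_exp_ofReal_mul_I, Complex.norm_real]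
    norm_num
  have hnorm (θ : ℝ) : ‖((2⁻¹ : ℝ) : ℂ) * cexp (θ * I)‖ ≤ 2⁻¹ := by
    rw [norm_mul, Complex.norm_exp_ofReal_mul_I, Complex.norm_real]
    norm_num
  have hcont (i : ι) : Continuous
      fun θ : ℝ => wToFun β (y i - x) (((2⁻¹ : ℝ) : ℂ) * cexp (θ * I)) :=
    (h.differentiableOn_wToFun (y i - x)).continuousOn.comp_continuous (by fun_prop) hmem
  have hlim : Tendsto (fun i => ∫⁻ θ : ℝ in Ioo (-π) π,
      ‖wToFun β (y i - x) (((2⁻¹ : ℝ) : ℂ) * cexp (θ * I))‖ₑ ^ 2) l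
      (𝓝 (∫⁻ _ : ℝ in Ioo (-π) π, 0)) := by
    refine tendsto_lintegral_filter_of_dominated_convergence
      (fun _ => ENNReal.ofReal (((K + ‖x‖) * (1 - 2⁻¹)⁻¹) ^ 2))
      (Eventually.of_forall fun i => ((hcont i).enorm.measurable.pow_const 2)) ?_ ?_ ?_
    · filter_upwards [hK] with i hi
      refine ae_of_all _ fun θ => ?_
      rw [enorm_sq_eq_ofReal]
      refine ENNReal.ofReal_le_ofReal ?_
      gcongr
      refine (h.norm_wToFun_le _ (by norm_num) (hnorm θ)).trans ?_
      gcongr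
      exact (norm_sub_le _ _).trans (by gcongr)
    · rw [lintegral_const]
      finiteness
    · refine ae_of_all _ fun θ => ?_
      have h1 := (hy _ (hmem θ)).sub_const (wToFun β x (((2⁻¹ : ℝ) : ℂ) * cexp (θ * I)))
      rw [sub_self] at h1
      simp_rw [← h.wToFun_sub _ _ (hmem θ)] at h1
      have h2 := (h1.norm.pow 2)
      simp_rw [enorm_sq_eq_ofReal]
      simpa using ENNReal.tendsto_ofReal h2
  rw [lintegral_zero] at hlim
  simp_rw [lintegral_circle_sq (fun z hz => h.hasSum_wToFun _ hz) hr] at hlim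
  set κ : ℝ := 2 * π * ((β n)⁻¹ ^ 2 * 2⁻¹ ^ (2 * n))
  have hβ := h.beta_pos n
  have hκ : 0 < κ := by positivity
  have hterm : Tendsto (fun i => ENNReal.ofReal (κ * ‖y i n - x n‖ ^ 2)) l (𝓝 0) := by
    refine tendsto_of_tendsto_of_tendsto_of_le_of_le tendsto_const_nhds hlim
      (fun _ => zero_le) fun i => ?_
    have := ENNReal.le_tsum (f := fun n => ‖(y i - x) n / (β n : ℂ)‖ₑ ^ 2 *
      ENNReal.ofReal ((2⁻¹ : ℝ) ^ (2 * n))) n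
    refine le_trans (le_of_eq ?_) (mul_le_mul_right this _)
    rw [enorm_sq_eq_ofReal, ← ENNReal.ofReal_mul (by positivity),
      ← ENNReal.ofReal_mul (by positivity), lp.coeFn_sub, Pi.sub_apply, norm_div,
      Complex.norm_real, Real.norm_of_nonneg hβ.le]
    congr 1
    simp only [κ]
    ring
  have h1 := (ENNReal.tendsto_toReal ENNReal.zero_ne_top).comp hterm
  have h2 : Tendsto (fun i => κ * ‖y i n - x n‖ ^ 2) l (𝓝 0) := by
    refine h1.congr fun i => ?_
    exact ENNReal.toReal_ofReal (by positivity)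
  have h3 := (h2.const_mul κ⁻¹).sqrt
  simp only [mul_zero, Real.sqrt_zero, inv_mul_cancel_left₀ hκ.ne',
    Real.sqrt_sq (norm_nonneg _)] at h3
  exact tendsto_iff_norm_sub_tendsto_zero.2 h3

end IsAreaSpace

namespace IsInwardFlow

variable {φ : ℝ → ℂ → ℂ} {G : ℂ → ℂ} {δ ρ : ℝ}

theorem one_le_const (h : IsInwardFlow φ G δ ρ) : 1 ≤ (1 - ρ ^ 2)⁻¹ :=
  (one_le_inv₀ h.one_sub_rho_sq_pos).2 (by nlinarith [sq_nonneg ρ])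

end IsInwardFlow

namespace IsAreaSpace

variable {β : ℕ → ℝ} {p : ℝ} {φ : ℝ → ℂ → ℂ} {G : ℂ → ℂ} {δ ρ : ℝ}

theorem exists_flowOp (h : IsAreaSpace β p) (hφ : IsInwardFlow φ G δ ρ) (t : ℝ) :
    ∃ T : WH2 →L[ℂ] WH2, RepresentsComp β T (φ (max t 0)) :=
  h.exists_compOp hφ.one_le_const (hφ.flow.2.1 _ (le_max_right t 0)).1
    (hφ.flow.2.1 _ (le_max_right t 0)).2 (hφ.injOn (le_max_right t 0))
    fun _ hz => hφ.one_sub_norm_sq_le (le_max_right t 0) hz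

/-- The composition operator with symbol `φ t`, extended by the identity to negative times. -/
noncomputable def flowOp (h : IsAreaSpace β p) (hφ : IsInwardFlow φ G δ ρ) (t : ℝ) :
    WH2 →L[ℂ] WH2 :=
  (h.exists_flowOp hφ t).choose

variable (h : IsAreaSpace β p) (hφ : IsInwardFlow φ G δ ρ)

theorem representsComp_flowOp_max (t : ℝ) : RepresentsComp β (h.flowOp hφ t) (φ (max t 0)) :=
  (h.exists_flowOp hφ t).choose_spec

theorem representsComp_flowOp {t : ℝ} (ht : 0 ≤ t) :
    RepresentsComp β (h.flowOp hφ t) (φ t) := by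
  simpa [ht] using h.representsComp_flowOp_max hφ t

theorem wToFun_flowOp {t : ℝ} (ht : 0 ≤ t) (f : WH2) {z : ℂ} (hz : z ∈ ball (0 : ℂ) 1) :
    wToFun β (h.flowOp hφ t f) z = wToFun β f (φ t z) :=
  (h.representsComp_flowOp hφ ht).2.2 f z hz

theorem flowOp_max (t : ℝ) : h.flowOp hφ (max t 0) = h.flowOp hφ t := by
  ext1 f
  refine h.wToFun_injective fun z hz => ?_
  rw [h.wToFun_flowOp hφ (le_max_right t 0) f hz, (h.representsComp_flowOp_max hφ t).2.2 f z hz]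

theorem flowOp_zero : h.flowOp hφ 0 = 1 := by
  ext1 f
  refine h.wToFun_injective fun z hz => ?_
  rw [h.wToFun_flowOp hφ le_rfl f hz, hφ.flow.1 z hz]
  rfl

theorem flowOp_add {s t : ℝ} (hs : 0 ≤ s) (ht : 0 ≤ t) :
    h.flowOp hφ (s + t) = (h.flowOp hφ s).comp (h.flowOp hφ t) := by
  ext1 f
  refine h.wToFun_injective fun z hz => ?_
  rw [h.wToFun_flowOp hφ (add_nonneg hs ht) f hz, ContinuousLinearMap.comp_apply,
    h.wToFun_flowOp hφ hs _ hz, h.wToFun_flowOp hφ ht f (hφ.mem_ball hs hz), add_comm s t,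
    hφ.flow.2.2.1 t s ht hs z hz]

theorem norm_sq_areaOp_flowOp_le {C t : ℝ} (hC : 1 ≤ C) (ht : 0 ≤ t)
    (hle : ∀ z ∈ ball (0 : ℂ) 1, 1 - ‖z‖ ^ 2 ≤ C * (1 - ‖φ t z‖ ^ 2)) (f : WH2) :
    ‖h.areaOp (h.flowOp hφ t f)‖ ^ 2 ≤
      ‖wToFun β f (φ t 0)‖ ^ 2 + C * (‖h.areaOp f‖ ^ 2 - ‖f 0‖ ^ 2) :=
  h.norm_sq_areaOp_comp_le hC (hφ.injOn ht) hle (h.representsComp_flowOp hφ ht) f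

theorem exists_norm_flowOp_le :
    ∃ K : ℝ, 0 ≤ K ∧ ∀ (t : ℝ) (f : WH2), ‖h.flowOp hφ t f‖ ≤ K * ‖f‖ := by
  have hC := hφ.one_le_const
  set C := (1 - ρ ^ 2)⁻¹
  refine ⟨Real.sqrt (2 * ((1 - ρ)⁻¹ ^ 2 + C)), Real.sqrt_nonneg _, fun t f => ?_⟩
  rw [← h.flowOp_max hφ]
  have ht : 0 ≤ max t 0 := le_max_right t 0
  have h1 := h.norm_sq_le_areaOp (h.flowOp hφ (max t 0) f)
  have h2 := h.norm_sq_areaOp_flowOp_le hφ hC ht (fun z hz => hφ.one_sub_norm_sq_le ht hz) f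
  have h3 : ‖wToFun β f (φ (max t 0) 0)‖ ^ 2 ≤ (‖f‖ * (1 - ρ)⁻¹) ^ 2 := by
    gcongr
    exact h.norm_wToFun_le f hφ.rho_lt_one (hφ.norm_zero_le ht)
  have h4 : ‖h.areaOp f‖ ^ 2 ≤ ‖f‖ ^ 2 := by
    gcongr
    exact h.norm_areaOp_le f
  have h5 : C * (‖h.areaOp f‖ ^ 2 - ‖f 0‖ ^ 2) ≤ C * ‖f‖ ^ 2 :=
    mul_le_mul_of_nonneg_left (by nlinarith [sq_nonneg ‖f 0‖]) (by linarith)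
  calc ‖h.flowOp hφ (max t 0) f‖ ≤ Real.sqrt (2 * ((1 - ρ)⁻¹ ^ 2 + C) * ‖f‖ ^ 2) := by
        refine Real.le_sqrt_of_sq_le ?_
        calc _ ≤ 2 * ((‖f‖ * (1 - ρ)⁻¹) ^ 2 + C * ‖f‖ ^ 2) := by linarith
          _ = _ := by ring
    _ = _ := by rw [Real.sqrt_mul (by positivity), Real.sqrt_sq (norm_nonneg _)]

theorem tendsto_flowOp (f : WH2) :
    Tendsto (fun t => h.flowOp hφ t f) (𝓝[≥] 0) (𝓝 f) := by
  obtain ⟨K, -, hK⟩ := h.exists_norm_flowOp_le hφ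
  obtain ⟨M, hM, hle⟩ := hφ.exists_one_sub_norm_sq_le
  have hpt : ∀ z ∈ ball (0 : ℂ) 1, Tendsto (fun t => wToFun β f (φ t z)) (𝓝[≥] 0)
      (𝓝 (wToFun β f z)) := by
    intro z hz
    have h1 : Tendsto (fun s => φ s z) (𝓝[≥] 0) (𝓝 z) := by
      have := (hφ.gen z hz 0 le_rfl).continuousAt.tendsto
      rw [hφ.flow.1 z hz] at this
      exact this.mono_left nhdsWithin_le_nhds
    exact ((h.differentiableOn_wToFun f).differentiableAt
      (isOpen_ball.mem_nhds hz)).continuousAt.tendsto.comp h1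
  have hcoord (n : ℕ) : Tendsto (fun t => h.flowOp hφ t f n) (𝓝[≥] 0) (𝓝 (f n)) := by
    refine h.tendsto_coord (K := K * ‖f‖) (Eventually.of_forall fun t => hK t f) ?_ n
    intro z hz
    refine (hpt z hz).congr' ?_
    filter_upwards [self_mem_nhdsWithin] with t ht
    rw [h.wToFun_flowOp hφ ht f hz]
  have hS : Tendsto (fun t => h.areaOp (h.flowOp hφ t f)) (𝓝[≥] 0) (𝓝 (h.areaOp f)) := by
    refine WH2.tendsto_of_coord (b := fun t => ‖wToFun β f (φ t 0)‖ ^ 2 +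
      (1 + M * t) * (‖h.areaOp f‖ ^ 2 - ‖f 0‖ ^ 2)) (fun n => (hcoord n).const_mul _) ?_ ?_
    · have h1 := (hpt 0 (mem_ball_self one_pos)).norm.pow 2
      have h2 : Tendsto (fun t : ℝ => (1 + M * t) * (‖h.areaOp f‖ ^ 2 - ‖f 0‖ ^ 2)) (𝓝[≥] 0)
          (𝓝 ((1 + M * 0) * (‖h.areaOp f‖ ^ 2 - ‖f 0‖ ^ 2))) :=
        (Continuous.tendsto (by fun_prop) 0).mono_left nhdsWithin_le_nhds
      have h3 := h1.add h2
      rw [h.wToFun_zero] at h3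
      convert h3 using 2
      ring
    · filter_upwards [self_mem_nhdsWithin] with t ht
      exact h.norm_sq_areaOp_flowOp_le hφ (by have := mul_nonneg hM ht; linarith) ht (hle t ht) f
  rw [tendsto_iff_norm_sub_tendsto_zero] at hS ⊢
  have h1 := ((hS.pow 2).const_mul 2).sqrt
  simp only [ne_eq, OfNat.ofNat_ne_zero, not_false_eq_true, zero_pow, mul_zero,
    Real.sqrt_zero] at h1
  refine squeeze_zero (fun _ => norm_nonneg _) (fun t => Real.le_sqrt_of_sq_le ?_) h1
  rw [← map_sub]
  exact h.norm_sq_le_areaOp _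

theorem isC0Semigroup_flowOp : IsC0Semigroup (h.flowOp hφ) :=
  ⟨h.flowOp_zero hφ, fun _ _ hs ht => h.flowOp_add hφ hs ht, h.tendsto_flowOp hφ⟩

theorem continuous_flowOp (f : WH2) : Continuous fun t => h.flowOp hφ t f := by
  obtain ⟨K, hK0, hK⟩ := h.exists_norm_flowOp_le hφ
  have key : ∀ s t : ℝ, 0 ≤ s → s ≤ t →
      ‖h.flowOp hφ t f - h.flowOp hφ s f‖ ≤ K * ‖h.flowOp hφ (t - s) f - f‖ := by
    intro s t hs hst
    have h1 : h.flowOp hφ t f = h.flowOp hφ s (h.flowOp hφ (t - s) f) := by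
      rw [← ContinuousLinearMap.comp_apply, ← h.flowOp_add hφ hs (sub_nonneg.2 hst),
        add_sub_cancel]
    rw [h1, ← map_sub]
    exact hK _ _
  have key' : ∀ s t : ℝ, ‖h.flowOp hφ t f - h.flowOp hφ s f‖ ≤
      K * ‖h.flowOp hφ |max t 0 - max s 0| f - f‖ := by
    intro s t
    rw [← h.flowOp_max hφ t, ← h.flowOp_max hφ s]
    rcases le_total (max s 0) (max t 0) with hst | hst
    · rw [abs_of_nonneg (sub_nonneg.2 hst)]
      exact key _ _ (le_max_right _ _) hst
    · rw [abs_of_nonpos (sub_nonpos.2 hst), neg_sub, norm_sub_rev]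
      exact key _ _ (le_max_right _ _) hst
  refine continuous_iff_continuousAt.2 fun s => tendsto_iff_norm_sub_tendsto_zero.2 ?_
  have h1 : Tendsto (fun t : ℝ => |max t 0 - max s 0|) (𝓝 s) (𝓝[≥] 0) := by
    refine tendsto_nhdsWithin_iff.2 ⟨?_, Eventually.of_forall fun t => mem_Ici.2 (abs_nonneg _)⟩
    have : Continuous fun t : ℝ => |max t 0 - max s 0| := by fun_prop
    simpa using this.tendsto s
  have h2 := (tendsto_iff_norm_sub_tendsto_zero.1 ((h.tendsto_flowOp hφ f).comp h1)).const_mul K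
  rw [mul_zero] at h2
  exact squeeze_zero (fun _ => norm_nonneg _) (fun t => key' s t) h2

end IsAreaSpace

theorem HasDerivAt.tendsto_complex_slope {E : Type*} [NormedAddCommGroup E]
    [NormedSpace ℂ E] {g : ℝ → E} {g' : E} (hg : HasDerivAt g g' 0) :
    Tendsto (fun t : ℝ => (t : ℂ)⁻¹ • (g t - g 0)) (𝓝[>] 0) (𝓝 g') := by
  have := hg.hasDerivWithinAt (s := Ioi 0)
  rw [hasDerivWithinAt_iff_tendsto_slope' self_notMem_Ioi] at this
  refine this.congr fun t => ?_
  rw [slope_def_module, sub_zero, ← Complex.ofReal_inv, Complex.coe_smul]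

namespace IsAreaSpace

variable {β : ℕ → ℝ} {p : ℝ} {φ : ℝ → ℂ → ℂ} {G : ℂ → ℂ} {δ ρ : ℝ}

/-- Point evaluation as a continuous linear functional. -/
noncomputable def evalCLM (h : IsAreaSpace β p) {z : ℂ} (hz : z ∈ ball (0 : ℂ) 1) :
    WH2 →L[ℂ] ℂ :=
  LinearMap.mkContinuous
    { toFun := fun f => wToFun β f z
      map_add' := fun f g => h.wToFun_add f g hz
      map_smul' := fun c f => h.wToFun_smul c f hz } (1 - ‖z‖)⁻¹ fun f => by
    rw [mul_comm]
    exact h.norm_wToFun_le f (by simpa using hz) le_rfl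

@[simp]
theorem evalCLM_apply (h : IsAreaSpace β p) {z : ℂ} (hz : z ∈ ball (0 : ℂ) 1) (f : WH2) :
    h.evalCLM hz f = wToFun β f z := rfl

variable (h : IsAreaSpace β p) (hφ : IsInwardFlow φ G δ ρ)

include h hφ in
theorem hasDerivAt_wToFun_flow (f : WH2) {z : ℂ} (hz : z ∈ ball (0 : ℂ) 1) {t : ℝ} (ht : 0 ≤ t) :
    HasDerivAt (fun s => wToFun β f (φ s z)) (G (φ t z) * deriv (wToFun β f) (φ t z)) t := by
  have hd : HasDerivAt (wToFun β f) (deriv (wToFun β f) (φ t z)) (φ t z) :=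
    ((h.differentiableOn_wToFun f).differentiableAt
      (isOpen_ball.mem_nhds (hφ.mem_ball ht hz))).hasDerivAt
  exact hd.scomp t (hφ.gen z hz t ht)

theorem wToFun_eq_of_genLimit {f g : WH2} (hfg : GenLimit (h.flowOp hφ) f g) {z : ℂ}
    (hz : z ∈ ball (0 : ℂ) 1) : wToFun β g z = G z * deriv (wToFun β f) z := by
  have h1 := ((h.evalCLM hz).continuous.tendsto g).comp hfg
  have h2 := (h.hasDerivAt_wToFun_flow hφ f hz le_rfl).tendsto_complex_slope
  simp only [hφ.flow.1 z hz] at h2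
  refine tendsto_nhds_unique h1 (h2.congr' ?_)
  filter_upwards [self_mem_nhdsWithin] with t ht
  simp only [Function.comp_apply, map_smul, map_sub, evalCLM_apply]
  rw [h.wToFun_flowOp hφ (le_of_lt ht) f hz]

theorem flowOp_sub_eq_integral {f g : WH2}
    (hfg : ∀ z ∈ ball (0 : ℂ) 1, wToFun β g z = G z * deriv (wToFun β f) z) {t : ℝ} (ht : 0 ≤ t) :
    h.flowOp hφ t f - f = ∫ s in (0 : ℝ)..t, h.flowOp hφ s g := by
  refine h.wToFun_injective fun z hz => ?_
  have hc := h.continuous_flowOp hφ g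
  rw [← h.evalCLM_apply hz, ← h.evalCLM_apply hz,
    ← ContinuousLinearMap.intervalIntegral_comp_comm _ (hc.intervalIntegrable _ _),
    intervalIntegral.integral_eq_sub_of_hasDerivAt (f := fun s => wToFun β f (φ s z))
      (f' := fun s => h.evalCLM hz (h.flowOp hφ s g)), map_sub, evalCLM_apply, evalCLM_apply,
    h.wToFun_flowOp hφ ht f hz, hφ.flow.1 z hz]
  · intro s hs
    rw [uIcc_of_le ht] at hs
    rw [evalCLM_apply, h.wToFun_flowOp hφ hs.1 g hz, hfg _ (hφ.mem_ball hs.1 hz)]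
    exact h.hasDerivAt_wToFun_flow hφ f hz hs.1
  · exact ((h.evalCLM hz).continuous.comp hc).intervalIntegrable _ _

theorem genLimit_of_wToFun_eq {f g : WH2}
    (hfg : ∀ z ∈ ball (0 : ℂ) 1, wToFun β g z = G z * deriv (wToFun β f) z) :
    GenLimit (h.flowOp hφ) f g := by
  have h1 := ((h.continuous_flowOp hφ g).integral_hasStrictDerivAt 0 0).hasDerivAt
  simp only [h.flowOp_zero hφ] at h1
  refine (HasDerivAt.tendsto_complex_slope h1).congr' ?_
  filter_upwards [self_mem_nhdsWithin] with t ht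
  rw [intervalIntegral.integral_same, sub_zero, h.flowOp_sub_eq_integral hφ hfg (le_of_lt ht)]

theorem isGenerator_flowOp : IsGenerator (h.flowOp hφ) (domA β G) (opA β G) := by
  refine ⟨fun f hf => h.genLimit_of_wToFun_eq hφ fun z hz => ?_,
    fun f ⟨g, hg⟩ => ⟨g, fun z hz => h.wToFun_eq_of_genLimit hφ hg hz⟩⟩
  rw [opA, dif_pos hf]
  exact hf.choose_spec z hz

end IsAreaSpace

theorem norm_pow_ofReal_le_one {r : ℝ} (hr0 : 0 ≤ r) (hr1 : r ≤ 1) (n : ℕ) :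
    ‖(r : ℂ) ^ n‖ ≤ 1 := by
  rw [norm_pow, Complex.norm_real, Real.norm_of_nonneg hr0]
  exact pow_le_one₀ hr0 hr1

/-- The composition operator with symbol `z ↦ r z`. -/
noncomputable def dilationOp {r : ℝ} (hr0 : 0 ≤ r) (hr1 : r ≤ 1) : WH2 →L[ℂ] WH2 :=
  diagOp (fun n => (r : ℂ) ^ n) (norm_pow_ofReal_le_one hr0 hr1)

theorem norm_dilationOp_single {r : ℝ} (hr0 : 0 ≤ r) (hr1 : r ≤ 1) (n : ℕ) :
    ‖dilationOp hr0 hr1 (lp.single 2 n (1 : ℂ))‖ = r ^ n := by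
  have : dilationOp hr0 hr1 (lp.single 2 n (1 : ℂ)) = lp.single 2 n ((r : ℂ) ^ n) := by
    ext k
    rcases eq_or_ne k n with rfl | hk
    · simp [dilationOp]
    · simp [dilationOp, hk]
  rw [this, lp.norm_single (by simp), norm_pow, Complex.norm_real, Real.norm_of_nonneg hr0]

theorem isHilbertSchmidt_comp_dilationOp {r : ℝ} (hr0 : 0 ≤ r) (hr1 : r < 1)
    (C : WH2 →L[ℂ] WH2) : IsHilbertSchmidt (C.comp (dilationOp hr0 hr1.le)) := by
  have hs : Summable fun n : ℕ => ‖C‖ ^ 2 * (r ^ 2) ^ n :=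
    (summable_geometric_of_lt_one (by positivity) (by nlinarith)).mul_left _
  refine Summable.of_nonneg_of_le (fun _ => by positivity) (fun n => ?_) hs
  have := C.le_opNorm (dilationOp hr0 hr1.le (lp.single 2 n (1 : ℂ)))
  rw [norm_dilationOp_single] at this
  rw [ContinuousLinearMap.comp_apply, ← pow_mul, mul_comm 2 n, pow_mul, ← mul_pow]
  gcongr

theorem isTraceClass_comp_dilationOp {r : ℝ} (hr0 : 0 ≤ r) (hr1 : r < 1)
    (C : WH2 →L[ℂ] WH2) : IsTraceClass (C.comp (dilationOp hr0 hr1.le)) := by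
  have hs0 : 0 ≤ Real.sqrt r := Real.sqrt_nonneg r
  have hs1 : Real.sqrt r < 1 := by rw [Real.sqrt_lt' one_pos]; simpa using hr1
  refine ⟨C.comp (dilationOp hs0 hs1.le),
    (ContinuousLinearMap.id ℂ WH2).comp (dilationOp hs0 hs1.le),
    isHilbertSchmidt_comp_dilationOp hs0 hs1 _, isHilbertSchmidt_comp_dilationOp hs0 hs1 _, ?_⟩
  rw [ContinuousLinearMap.id_comp, ContinuousLinearMap.comp_assoc]
  congr 1
  ext f n
  simp only [dilationOp, ContinuousLinearMap.comp_apply, diagOp_apply]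
  rw [← mul_assoc, ← mul_pow, ← Complex.ofReal_mul, Real.mul_self_sqrt hr0]

theorem isCompactOperator_dilationOp {r : ℝ} (hr0 : 0 ≤ r) (hr1 : r < 1) :
    IsCompactOperator (dilationOp hr0 hr1.le) := by
  let R (n : ℕ) : WH2 →L[ℂ] WH2 :=
    (ContinuousLinearMap.toSpanSingleton ℂ (lp.single 2 n ((r : ℂ) ^ n) : WH2)).comp
      (lp.evalCLM ℂ (fun _ : ℕ => ℂ) 2 n)
  have hR (n : ℕ) : IsCompactOperator (R n) :=
    ((isCompactOperator_id (E := ℂ)).comp_clm (lp.evalCLM ℂ (fun _ : ℕ => ℂ) 2 n)).clm_comp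
      (ContinuousLinearMap.toSpanSingleton ℂ (lp.single 2 n ((r : ℂ) ^ n) : WH2))
  let F (N : ℕ) : WH2 →L[ℂ] WH2 := ∑ n ∈ Finset.range N, R n
  have hF (N : ℕ) : IsCompactOperator (F N) :=
    (Submodule.sum_mem (compactOperator (RingHom.id ℂ) WH2 WH2) fun n _ => hR n :)
  have hcoord (N : ℕ) (f : WH2) (k : ℕ) :
      F N f k = if k < N then (r : ℂ) ^ k * f k else 0 := by
    have hk (n : ℕ) : R n f k = if n = k then (r : ℂ) ^ k * f k else 0 := by
      rcases eq_or_ne n k with rfl | hne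
      · simp [R, mul_comm, lp.evalCLM]
      · simp [R, hne, hne.symm]
    simp only [F, sum_apply, lp.coeFn_sum, Finset.sum_apply, hk]
    simp
  refine isCompactOperator_of_tendsto (l := atTop) (F := F) ?_ (Eventually.of_forall hF)
  rw [tendsto_iff_norm_sub_tendsto_zero]
  refine squeeze_zero (fun _ => norm_nonneg _) (fun N => ?_)
    (tendsto_pow_atTop_nhds_zero_of_lt_one hr0 hr1)
  refine ContinuousLinearMap.opNorm_le_bound _ (by positivity) fun f => ?_
  have : r ^ N * ‖f‖ = ‖((r : ℂ) ^ N) • f‖ := by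
    rw [norm_smul, norm_pow, Complex.norm_real, Real.norm_of_nonneg hr0]
  rw [this]
  refine lp.norm_mono (by simp) fun k => ?_
  simp only [sub_apply, lp.coeFn_sub, Pi.sub_apply, hcoord, dilationOp,
    diagOp_apply, lp.coeFn_smul, Pi.smul_apply, smul_eq_mul]
  split_ifs with hk
  · simp only [sub_self, norm_zero]
    positivity
  · rw [zero_sub, norm_neg, norm_mul, norm_mul, norm_pow, norm_pow, Complex.norm_real,
      Real.norm_of_nonneg hr0]
    exact mul_le_mul_of_nonneg_right (pow_le_pow_of_le_one hr0 hr1.le (not_lt.1 hk))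
      (norm_nonneg _)

namespace IsAreaSpace

variable {β : ℕ → ℝ} {p : ℝ} {φ : ℝ → ℂ → ℂ} {G : ℂ → ℂ} {δ ρ : ℝ}

theorem exists_flowOp_eq_comp_dilationOp (h : IsAreaSpace β p) (hφ : IsInwardFlow φ G δ ρ)
    {t : ℝ} (ht : 0 < t) : ∃ (r : ℝ) (hr0 : 0 ≤ r) (hr1 : r < 1) (C : WH2 →L[ℂ] WH2),
      h.flowOp hφ t = C.comp (dilationOp hr0 hr1.le) := by
  obtain ⟨r, hr0, hr1, hle⟩ := hφ.exists_norm_le ht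
  obtain ⟨r', hrr', hr'1⟩ := exists_between hr1
  have hr'0 : 0 < r' := hr0.trans hrr'
  have hr'c : (r' : ℂ) ≠ 0 := by exact_mod_cast hr'0.ne'
  have hq1 : r / r' < 1 := (div_lt_one hr'0).2 hrr'
  have hq0 : 0 < r / r' := by positivity
  have hnorm : ∀ z ∈ ball (0 : ℂ) 1, ‖φ t z / r'‖ ≤ r / r' := fun z hz => by
    rw [norm_div, Complex.norm_real, Real.norm_of_nonneg hr'0.le]
    gcongr
    exact hle z hz
  have hmaps : MapsTo (fun z => φ t z / r') (ball 0 1) (ball 0 1) := fun z hz =>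
    mem_ball_zero_iff.2 ((hnorm z hz).trans_lt hq1)
  have hpos : 0 < 1 - (r / r') ^ 2 := by nlinarith
  obtain ⟨C, hC⟩ := h.exists_compOp (C := (1 - (r / r') ^ 2)⁻¹)
    ((one_le_inv₀ hpos).2 (by nlinarith)) ((hφ.flow.2.1 t ht.le).1.div_const _) hmaps
    (fun z hz w hw hzw => hφ.injOn ht.le hz hw ((div_left_inj' hr'c).1 hzw)) fun z hz => by
      rw [inv_mul_eq_div, le_div_iff₀ hpos]
      have h1 : ‖φ t z / r'‖ ^ 2 ≤ (r / r') ^ 2 := by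
        gcongr
        exact hnorm z hz
      nlinarith [sq_nonneg ‖z‖]
  refine ⟨r', hr'0.le, hr'1, C, ?_⟩
  ext1 f
  refine h.wToFun_injective fun z hz => ?_
  rw [h.wToFun_flowOp hφ ht.le f hz, ContinuousLinearMap.comp_apply, hC.2.2 _ z hz]
  refine tsum_congr fun n => ?_
  rw [dilationOp, diagOp_apply, div_pow]
  field_simp

end IsAreaSpace

theorem IsAreaSpace.exists_flow_semigroup {β : ℕ → ℝ} {p : ℝ} {φ : ℝ → ℂ → ℂ} {G : ℂ → ℂ}
    {δ ρ : ℝ} (h : IsAreaSpace β p) (hφ : IsInwardFlow φ G δ ρ) :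
    ∃ T : ℝ → WH2 →L[ℂ] WH2, IsC0Semigroup T ∧ IsGenerator T (domA β G) (opA β G) ∧
      (∀ t : ℝ, 0 ≤ t → RepresentsComp β (T t) (φ t)) ∧
      (∀ t : ℝ, 0 < t → IsCompactOperator (T t)) ∧
      (∀ t : ℝ, 0 < t → IsTraceClass (T t)) := by
  refine ⟨h.flowOp hφ, h.isC0Semigroup_flowOp hφ, h.isGenerator_flowOp hφ,
    fun t ht => h.representsComp_flowOp hφ ht, fun t ht => ?_, fun t ht => ?_⟩
  · obtain ⟨r, hr0, hr1, C, hC⟩ := h.exists_flowOp_eq_comp_dilationOp hφ ht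
    rw [hC]
    exact (isCompactOperator_dilationOp hr0 hr1).clm_comp C
  · obtain ⟨r, hr0, hr1, C, hC⟩ := h.exists_flowOp_eq_comp_dilationOp hφ ht
    rw [hC]
    exact isTraceClass_comp_dilationOp hr0 hr1 C

/-- If `Re (z̄ G(z)) ≤ -δ` on the annulus `1 - ε < |z| < 1`, then
`A f = G f'` generates an immediately compact — indeed immediately trace-class —
semigroup of composition operators on `H²(𝔻)` and `𝒟`; moreover
`‖φ_t‖_∞ ≤ max {√(1 - 2δt), √((1-ε)² + t₀ M)} < 1` for `0 < t ≤ t₀`. -/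
theorem statement10 (G : ℂ → ℂ) (hG : DifferentiableOn ℂ G uDisc)
    (φ : ℝ → ℂ → ℂ) (hφ : IsSemiflow φ) (hgen : SemiflowGenerator φ G)
    (δ ε : ℝ) (hδ : 0 < δ) (hε : 0 < ε)
    (hbd : ∀ z : ℂ, 1 - ε < ‖z‖ → ‖z‖ < 1 → (((starRingEnd ℂ) z) * G z).re ≤ -δ) :
    (∀ β : ℕ → ℝ, β = hardyW ∨ β = dirichletW →
      ∃ T : ℝ → WH2 →L[ℂ] WH2, IsC0Semigroup T ∧
        IsGenerator T (domA β G) (opA β G) ∧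
        (∀ t : ℝ, 0 ≤ t → RepresentsComp β (T t) (φ t)) ∧
        (∀ t : ℝ, 0 < t → IsCompactOperator (T t)) ∧
        (∀ t : ℝ, 0 < t → IsTraceClass (T t))) ∧
    ∃ t₀ : ℝ, 0 < t₀ ∧ ∃ M : ℝ, 0 < M ∧
      ∀ t : ℝ, 0 < t → t ≤ t₀ →
        (∀ z ∈ uDisc, ‖φ t z‖ ≤
          max (Real.sqrt (1 - 2 * δ * t)) (Real.sqrt ((1 - ε) ^ 2 + t₀ * M))) ∧
        max (Real.sqrt (1 - 2 * δ * t)) (Real.sqrt ((1 - ε) ^ 2 + t₀ * M)) < 1 := by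
  have hε1 : ε < 1 := lt_one_of_inward
    (hG.differentiableAt (isOpen_ball.mem_nhds (mem_ball_self one_pos))).continuousAt hδ hbd
  have h : IsInwardFlow φ G δ (1 - ε) :=
    ⟨hφ, hgen, hG, hδ, by linarith, by linarith, hbd⟩
  refine ⟨?_, h.exists_norm_le_max⟩
  rintro β (rfl | rfl)
  · exact isAreaSpace_hardyW.exists_flow_semigroup h
  · exact isAreaSpace_dirichletW.exists_flow_semigroup h
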